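/- arXiv:2004.01625 — 8 statements merged into one kernel-verified Lean document; each statement's English description precedes it below -/
import Mathlib

section
/- Let f : ℝ^n × ℝ^m → ℝ^n be twice continuously differentiable and let (x_s, u_s) be a steady state, i.e. x_s = f(x_s, u_s). Let A = D_x f(x_s, u_s) ∈ ℝ^{n×n} and fix an integer M ≥ 1 such that the matrix I_n − A^M is invertible (which holds in particular if no eigenvalue λ of A satisfies λ^M = 1). Then there exist an open set U ⊆ (ℝ^m)^M containing the constant input sequence (u_s, …, u_s) and a continuously differentiable map g : U → ℝ^n with g(u_s, …, u_s) = x_s such that for every input sequence u = (u(0), …, u(M−1)) ∈ U, the trajectory defined by x(0) = g(u) and x(k+1) = f(x(k), u(k)) for 0 ≤ k ≤ M−1 satisfies x(M) = x(0); that is, applying the input sequence u periodically from the initial condition g(u) yields a feasible period-M trajectory of the noise-free system x_{k+1} = f(x_k, u_k). -/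
open Matrix

/-- Trajectory of the discrete-time system `x_{k+1} = f (x_k, u_k)` from
initial state `x0` under the input sequence `u`. -/
def trajectory {n m : ℕ} (f : (Fin n → ℝ) × (Fin m → ℝ) → (Fin n → ℝ))
    (x0 : Fin n → ℝ) (u : ℕ → (Fin m → ℝ)) : ℕ → (Fin n → ℝ)
  | 0 => x0
  | k + 1 => f (trajectory f x0 u k, u k)

/-- Under a constant input the trajectory is the iteration of `x ↦ f (x, v)`. -/
theorem trajectory_const {n m : ℕ} (f : (Fin n → ℝ) × (Fin m → ℝ) → (Fin n → ℝ))
    (x : Fin n → ℝ) (v : Fin m → ℝ) (k : ℕ) :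
    trajectory f x (fun _ => v) k = (fun y => f (y, v))^[k] x := by
  induction k with
  | zero => rfl
  | succ k ih => rw [Function.iterate_succ_apply', ← ih, trajectory]

/-- The state at time `k` depends smoothly on parameters if the initial state and inputs do. -/
theorem ContDiff.trajectory {n m : ℕ} {f : (Fin n → ℝ) × (Fin m → ℝ) → (Fin n → ℝ)}
    {E : Type*} [NormedAddCommGroup E] [NormedSpace ℝ E] {r : WithTop ℕ∞} (hf : ContDiff ℝ r f)
    {x : E → Fin n → ℝ} {u : E → ℕ → Fin m → ℝ} (hx : ContDiff ℝ r x)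
    (hu : ∀ k, ContDiff ℝ r fun p => u p k) (k : ℕ) :
    ContDiff ℝ r fun p => trajectory f (x p) (u p) k := by
  induction k with
  | zero => exact hx
  | succ k ih => exact hf.comp (ih.prodMk (hu k))

theorem ContinuousLinearMap.isInvertible_of_isUnit {𝕜 E : Type*} [NontriviallyNormedField 𝕜]
    [NormedAddCommGroup E] [NormedSpace 𝕜 E] {L : E →L[𝕜] E} (h : IsUnit L) : L.IsInvertible := by
  obtain ⟨v, rfl⟩ := h
  exact ⟨ContinuousLinearEquiv.ofUnit v, rfl⟩

/-- If `1 - A ^ k` is invertible for the matrix `A` of `L`, then `1 - L ^ k` is invertible. -/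
theorem ContinuousLinearMap.isUnit_one_sub_pow_of_toMatrix' {n : ℕ}
    (L : (Fin n → ℝ) →L[ℝ] (Fin n → ℝ)) (k : ℕ)
    (h : IsUnit (1 - LinearMap.toMatrix' (L : (Fin n → ℝ) →ₗ[ℝ] (Fin n → ℝ)) ^ k)) :
    IsUnit (1 - L ^ k) := by
  have h' := (h.map Matrix.toLinAlgEquiv').map (Module.End.toContinuousLinearMap (Fin n → ℝ))
  have hL : Module.End.toContinuousLinearMap (Fin n → ℝ) (Matrix.toLinAlgEquiv'
      (LinearMap.toMatrix' (L : (Fin n → ℝ) →ₗ[ℝ] (Fin n → ℝ)))) = L := by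
    ext x : 1
    change Matrix.toLin' (LinearMap.toMatrix' (L : (Fin n → ℝ) →ₗ[ℝ] (Fin n → ℝ))) x = L x
    simp
  simpa only [map_sub, map_one, map_pow, hL] using h'

/-- Lemma on existence of feasible period-`M` trajectories.
If `f` is `C²`, `(x_s, u_s)` is a steady state, `A = D_x f(x_s,u_s)` and
`I - A^M` is invertible, then there are an open set `U` of input sequences
containing the constant sequence `(u_s,…,u_s)` and a `C¹` map `g` on `U` with
`g(u_s,…,u_s) = x_s` such that for each `u ∈ U` the trajectory started at
`g u` under `u` returns to `g u` after `M` steps. -/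
theorem feasible_periodic_reference_exists
    {n m : ℕ} (f : (Fin n → ℝ) × (Fin m → ℝ) → (Fin n → ℝ))
    (hf : ContDiff ℝ 2 f)
    (x_s : Fin n → ℝ) (u_s : Fin m → ℝ)
    (hsteady : x_s = f (x_s, u_s))
    (A : Matrix (Fin n) (Fin n) ℝ)
    (hA : A = LinearMap.toMatrix'
      ((fderiv ℝ (fun x => f (x, u_s)) x_s : (Fin n → ℝ) →L[ℝ] (Fin n → ℝ)) :
        (Fin n → ℝ) →ₗ[ℝ] (Fin n → ℝ)))
    (M : ℕ) (hM : 1 ≤ M)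
    (hinv : IsUnit ((1 : Matrix (Fin n) (Fin n) ℝ) - A ^ M)) :
    ∃ (U : Set (Fin M → (Fin m → ℝ))) (g : (Fin M → (Fin m → ℝ)) → (Fin n → ℝ)),
      IsOpen U ∧ (fun _ : Fin M => u_s) ∈ U ∧
      ContDiffOn ℝ 1 g U ∧ g (fun _ : Fin M => u_s) = x_s ∧
      ∀ u ∈ U,
        trajectory f (g u) (fun k => if h : k < M then u ⟨k, h⟩ else u_s) M = g u := by
  let inputs : (Fin M → Fin m → ℝ) → ℕ → Fin m → ℝ :=
    fun u k => if h : k < M then u ⟨k, h⟩ else u_s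
  let F : (Fin M → Fin m → ℝ) × (Fin n → ℝ) → (Fin n → ℝ) :=
    fun p => p.2 - trajectory f p.2 (inputs p.1) M
  let p₀ : (Fin M → Fin m → ℝ) × (Fin n → ℝ) := (fun _ => u_s, x_s)
  have hinputs : ∀ k, ContDiff ℝ 2
      fun p : (Fin M → Fin m → ℝ) × (Fin n → ℝ) => inputs p.1 k := by
    intro k
    by_cases hk : k < M
    · simp only [inputs, hk, dif_pos]
      fun_prop
    · simp only [inputs, hk, dif_neg, not_false_iff]
      fun_prop
  have hF : ContDiff ℝ 2 F := contDiff_snd.sub (hf.trajectory contDiff_snd hinputs M)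
  have hconst : inputs (fun _ => u_s) = fun _ => u_s := by
    funext k
    simp [inputs]
  have hfix : F p₀ = 0 := by
    simp only [F, p₀, hconst, trajectory_const]
    rw [Function.iterate_fixed hsteady.symm, sub_self]
  have hinr : fderiv ℝ F p₀ ∘L .inr ℝ _ _ =
      1 - (fderiv ℝ (fun x => f (x, u_s)) x_s) ^ M := by
    have hfx : Differentiable ℝ fun x => f (x, u_s) :=
      (hf.differentiable two_ne_zero).comp (by fun_prop)
    have h₁ : HasFDerivAt (fun x => F (fun _ => u_s, x))
        (fderiv ℝ F p₀ ∘L .inr ℝ _ _) x_s :=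
      HasFDerivAt.comp x_s (hF.differentiable two_ne_zero p₀).hasFDerivAt
        (hasFDerivAt_prodMk_right _ x_s)
    have h₂ : HasFDerivAt (fun x => F (fun _ => u_s, x))
        (1 - (fderiv ℝ (fun x => f (x, u_s)) x_s) ^ M) x_s := by
      simp only [F, hconst, trajectory_const]
      exact (hasFDerivAt_id x_s).sub ((hfx x_s).hasFDerivAt.iterate hsteady.symm M)
    exact h₁.unique h₂
  have hinv' : (fderiv ℝ F p₀ ∘L .inr ℝ _ _).IsInvertible := by
    rw [hinr]
    exact ContinuousLinearMap.isInvertible_of_isUnit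
      (ContinuousLinearMap.isUnit_one_sub_pow_of_toMatrix' _ M (hA ▸ hinv))
  have hFp : ContDiffAt ℝ 2 F p₀ := hF.contDiffAt
  let g := hFp.implicitFunction two_ne_zero hinv'
  have hg : ContDiffAt ℝ 2 g p₀.1 := hFp.contDiffAt_implicitFunction two_ne_zero hinv'
  have hev := (hg.eventually (by simp)).and
    (hFp.eventually_apply_implicitFunction two_ne_zero hinv')
  obtain ⟨U, hU, hUo, hmem⟩ := eventually_nhds_iff.mp hev
  refine ⟨U, g, hUo, hmem, fun u hu => ?_,
    hFp.implicitFunction_apply_self two_ne_zero hinv', fun u hu => ?_⟩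
  · exact ((hU u hu).1.of_le one_le_two).contDiffWithinAt
  · exact (sub_eq_zero.mp ((hU u hu).2.trans hfix)).symm
end

section
/- In the setting of the previous result (f : ℝ^n × ℝ^m → ℝ^n twice continuously differentiable, steady state x_s = f(x_s, u_s), A = D_x f(x_s, u_s), B = D_u f(x_s, u_s), I_n − A^M invertible, and g : U → ℝ^n the C¹ map with g(u_s,…,u_s) = x_s solving the period-M closure equation), the derivative of g at the constant sequence (u_s, …, u_s) equals the n × Mm matrix (I_n − A^M)^{-1} [A^{M−1}B, A^{M−2}B, …, AB, B]. Moreover, if M ≥ n and the pair (A, B) is controllable, i.e. the controllability matrix [B, AB, …, A^{n−1}B] has rank n, then this derivative has rank n. -/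
open Matrix

/-- Derivative of a joint function along a pair of curves, through the Jacobian matrices of its
partial maps. -/
theorem hasDerivAt_comp_prodMk_of_partial {n m : ℕ}
    {f : (Fin n → ℝ) × (Fin m → ℝ) → (Fin n → ℝ)} {x_s : Fin n → ℝ} {u_s : Fin m → ℝ}
    (hf : DifferentiableAt ℝ f (x_s, u_s))
    {x : ℝ → Fin n → ℝ} {u : ℝ → Fin m → ℝ} {v : Fin n → ℝ} {d : Fin m → ℝ} {t : ℝ}
    (hx : HasDerivAt x v t) (hxt : x t = x_s) (hu : HasDerivAt u d t) (hut : u t = u_s) :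
    HasDerivAt (fun s => f (x s, u s))
      (LinearMap.toMatrix'
          ((fderiv ℝ (fun x => f (x, u_s)) x_s : (Fin n → ℝ) →L[ℝ] (Fin n → ℝ)) :
            (Fin n → ℝ) →ₗ[ℝ] (Fin n → ℝ)) *ᵥ v +
        LinearMap.toMatrix'
          ((fderiv ℝ (fun u => f (x_s, u)) u_s : (Fin m → ℝ) →L[ℝ] (Fin n → ℝ)) :
            (Fin m → ℝ) →ₗ[ℝ] (Fin n → ℝ)) *ᵥ d) t := by
  subst hxt hut
  have hfst : HasFDerivAt (fun y => f (y, u t)) _ (x t) :=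
    hf.hasFDerivAt.comp (x t) (hasFDerivAt_prodMk_left (x t) (u t))
  have hsnd : HasFDerivAt (fun w => f (x t, w)) _ (u t) :=
    hf.hasFDerivAt.comp (u t) (hasFDerivAt_prodMk_right (x t) (u t))
  have hmain := hf.hasFDerivAt.comp_hasDerivAt t (hx.prodMk hu)
  rw [hfst.fderiv, hsnd.fderiv, LinearMap.toMatrix'_mulVec, LinearMap.toMatrix'_mulVec]
  refine hmain.congr_deriv ?_
  have hsplit : (v, d) = (v, (0 : Fin m → ℝ)) + ((0 : Fin n → ℝ), d) := by simp
  rw [hsplit, map_add]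
  rfl

/-- Along a curve of initial states and input sequences through a steady state, the derivative of
the trajectory is given by the variation of constants formula. -/
theorem hasDerivAt_trajectory {n m : ℕ}
    {f : (Fin n → ℝ) × (Fin m → ℝ) → (Fin n → ℝ)} {x_s : Fin n → ℝ} {u_s : Fin m → ℝ}
    (hf : DifferentiableAt ℝ f (x_s, u_s)) (hsteady : x_s = f (x_s, u_s))
    {A : Matrix (Fin n) (Fin n) ℝ} {B : Matrix (Fin n) (Fin m) ℝ}
    (hA : A = LinearMap.toMatrix'
      ((fderiv ℝ (fun x => f (x, u_s)) x_s : (Fin n → ℝ) →L[ℝ] (Fin n → ℝ)) :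
        (Fin n → ℝ) →ₗ[ℝ] (Fin n → ℝ)))
    (hB : B = LinearMap.toMatrix'
      ((fderiv ℝ (fun u => f (x_s, u)) u_s : (Fin m → ℝ) →L[ℝ] (Fin n → ℝ)) :
        (Fin m → ℝ) →ₗ[ℝ] (Fin n → ℝ)))
    {x : ℝ → Fin n → ℝ} {u : ℝ → ℕ → Fin m → ℝ} {v : Fin n → ℝ} {d : ℕ → Fin m → ℝ} {t : ℝ}
    (hx : HasDerivAt x v t) (hxt : x t = x_s)
    (hu : ∀ k, HasDerivAt (fun s => u s k) (d k) t) (hut : ∀ k, u t k = u_s) (k : ℕ) :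
    trajectory f (x t) (u t) k = x_s ∧
      HasDerivAt (fun s => trajectory f (x s) (u s) k)
        (A ^ k *ᵥ v + ∑ j ∈ Finset.range k, (A ^ (k - 1 - j) * B) *ᵥ d j) t := by
  induction k with
  | zero => simpa [trajectory, hxt] using hx
  | succ k ih =>
    refine ⟨by rw [trajectory, ih.1, hut, ← hsteady], ?_⟩
    have h := hasDerivAt_comp_prodMk_of_partial hf ih.2 ih.1 (hu k) (hut k)
    rw [← hA, ← hB] at h
    refine h.congr_deriv (Eq.symm ?_)
    rw [Finset.sum_range_succ, mulVec_add, mulVec_mulVec, ← pow_succ', mulVec_sum, ← add_assoc]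
    congr 2
    · refine Finset.sum_congr rfl fun j hj => ?_
      have hj : k + 1 - 1 - j = k - 1 - j + 1 := by
        have := Finset.mem_range.mp hj
        omega
      rw [hj, pow_succ', mulVec_mulVec, Matrix.mul_assoc]
    · simp

/-- If the controllability matrix has rank `n`, every state is reached by a linear combination of
the columns of `[A^{M-1}B, …, AB, B]`, for each `M ≥ n`. -/
theorem exists_sum_pow_mul_mulVec_eq {n m M : ℕ}
    {A : Matrix (Fin n) (Fin n) ℝ} {B : Matrix (Fin n) (Fin m) ℝ} (hnM : n ≤ M)
    (hrank : (Matrix.of (fun (i : Fin n) (p : Fin n × Fin m) =>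
      (A ^ (p.1 : ℕ) * B) i p.2)).rank = n) (z : Fin n → ℝ) :
    ∃ d : Fin M → Fin m → ℝ, ∑ k : Fin M, (A ^ (M - 1 - (k : ℕ)) * B) *ᵥ d k = z := by
  have htop : LinearMap.range (Matrix.of (fun (i : Fin n) (p : Fin n × Fin m) =>
      (A ^ (p.1 : ℕ) * B) i p.2)).mulVecLin = ⊤ :=
    Submodule.eq_top_of_finrank_eq (by simpa [Matrix.rank] using hrank)
  obtain ⟨c, hc⟩ := LinearMap.range_eq_top.mp htop z
  let e : ℕ → Fin m → ℝ := fun p => if h : p < n then fun j => c (⟨p, h⟩, j) else 0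
  refine ⟨fun k => e (M - 1 - k), ?_⟩
  rw [Fin.sum_univ_eq_sum_range (fun k => (A ^ (M - 1 - k) * B) *ᵥ e (M - 1 - k)),
    Finset.sum_range_reflect (fun k => (A ^ k * B) *ᵥ e k),
    ← Finset.sum_subset (Finset.range_mono hnM), ← Fin.sum_univ_eq_sum_range, ← hc]
  · ext i
    simp [mulVec, dotProduct, Fintype.sum_prod_type, e]
  · intro k _ hk
    simp [e, Finset.mem_range.not.mp hk]

/-- In the setting of the period-`M` closure map `g`
produced by the implicit function theorem, the derivative of `g` at the
constant input sequence `(u_s,…,u_s)` is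
`(I − A^M)⁻¹ [A^{M−1}B, …, AB, B]`, and if `M ≥ n` and `(A,B)` is
controllable this derivative has rank `n`. -/
theorem deriv_of_periodic_closure_map
    {n m : ℕ} (f : (Fin n → ℝ) × (Fin m → ℝ) → (Fin n → ℝ))
    (hf : ContDiff ℝ 2 f)
    (x_s : Fin n → ℝ) (u_s : Fin m → ℝ)
    (hsteady : x_s = f (x_s, u_s))
    (A : Matrix (Fin n) (Fin n) ℝ) (B : Matrix (Fin n) (Fin m) ℝ)
    (hA : A = LinearMap.toMatrix'
      ((fderiv ℝ (fun x => f (x, u_s)) x_s : (Fin n → ℝ) →L[ℝ] (Fin n → ℝ)) :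
        (Fin n → ℝ) →ₗ[ℝ] (Fin n → ℝ)))
    (hB : B = LinearMap.toMatrix'
      ((fderiv ℝ (fun u => f (x_s, u)) u_s : (Fin m → ℝ) →L[ℝ] (Fin n → ℝ)) :
        (Fin m → ℝ) →ₗ[ℝ] (Fin n → ℝ)))
    (M : ℕ) (hM : 1 ≤ M)
    (hinv : IsUnit ((1 : Matrix (Fin n) (Fin n) ℝ) - A ^ M).det)
    (U : Set (Fin M → (Fin m → ℝ))) (g : (Fin M → (Fin m → ℝ)) → (Fin n → ℝ))
    (hU : IsOpen U) (hUs : (fun _ : Fin M => u_s) ∈ U)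
    (hg : ContDiffOn ℝ 1 g U) (hgs : g (fun _ : Fin M => u_s) = x_s)
    (hper : ∀ u ∈ U,
      trajectory f (g u) (fun k => if h : k < M then u ⟨k, h⟩ else u_s) M = g u) :
    (∀ δu : Fin M → (Fin m → ℝ),
      fderiv ℝ g (fun _ : Fin M => u_s) δu =
        ((1 : Matrix (Fin n) (Fin n) ℝ) - A ^ M)⁻¹ *ᵥ
          (∑ k : Fin M, (A ^ (M - 1 - (k : ℕ)) * B) *ᵥ δu k)) ∧
    (n ≤ M →
      (Matrix.of (fun (i : Fin n) (p : Fin n × Fin m) =>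
          (A ^ (p.1 : ℕ) * B) i p.2)).rank = n →
      Module.finrank ℝ
        (LinearMap.range
          ((fderiv ℝ g (fun _ : Fin M => u_s) :
              (Fin M → (Fin m → ℝ)) →L[ℝ] (Fin n → ℝ)) :
            (Fin M → (Fin m → ℝ)) →ₗ[ℝ] (Fin n → ℝ))) = n) := by
  have hdiff : DifferentiableAt ℝ g (fun _ : Fin M => u_s) :=
    (hg.contDiffAt (hU.mem_nhds hUs)).differentiableAt (by simp)
  have hderiv : ∀ δu : Fin M → (Fin m → ℝ),
      fderiv ℝ g (fun _ : Fin M => u_s) δu =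
        ((1 : Matrix (Fin n) (Fin n) ℝ) - A ^ M)⁻¹ *ᵥ
          (∑ k : Fin M, (A ^ (M - 1 - (k : ℕ)) * B) *ᵥ δu k) := by
    intro δu
    let c : ℝ → Fin M → Fin m → ℝ := fun t => (fun _ => u_s) + t • δu
    have hc0 : c 0 = fun _ => u_s := by simp [c]
    have hc : HasDerivAt c δu 0 := by
      have h := ((hasDerivAt_id (0 : ℝ)).smul_const δu).const_add (fun _ : Fin M => u_s)
      rwa [one_smul] at h
    have hgc : HasDerivAt (fun t => g (c t)) (fderiv ℝ g (fun _ : Fin M => u_s) δu) 0 := by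
      rw [← hc0] at hdiff ⊢
      exact hdiff.hasFDerivAt.comp_hasDerivAt 0 hc
    have hu : ∀ k, HasDerivAt (fun t => if h : k < M then c t ⟨k, h⟩ else u_s)
        (if h : k < M then δu ⟨k, h⟩ else 0) 0 := by
      intro k
      by_cases h : k < M
      · simpa [h] using hasDerivAt_pi.mp hc ⟨k, h⟩
      · simpa [h] using hasDerivAt_const (0 : ℝ) u_s
    have htraj := (hasDerivAt_trajectory (hf.differentiable (by simp) _) hsteady hA hB hgc
      (by rw [hc0, hgs]) hu (by simp [hc0]) M).2
    have hev : (fun t => g (c t)) =ᶠ[nhds 0] fun t =>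
        trajectory f (g (c t)) (fun k => if h : k < M then c t ⟨k, h⟩ else u_s) M := by
      have hmem : ∀ᶠ t in nhds 0, c t ∈ U :=
        hc.continuousAt.eventually_mem (by rw [hc0]; exact hU.mem_nhds hUs)
      filter_upwards [hmem] with t ht using (hper _ ht).symm
    have heq := hgc.unique (htraj.congr_of_eventuallyEq hev)
    rw [← Fin.sum_univ_eq_sum_range
      (fun k => (A ^ (M - 1 - k) * B) *ᵥ if h : k < M then δu ⟨k, h⟩ else 0)] at heq
    simp only [Fin.is_lt, dite_true, Fin.eta] at heq
    have hsolve : ((1 : Matrix (Fin n) (Fin n) ℝ) - A ^ M) *ᵥ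
        fderiv ℝ g (fun _ : Fin M => u_s) δu =
          ∑ k : Fin M, (A ^ (M - 1 - (k : ℕ)) * B) *ᵥ δu k := by
      rw [sub_mulVec, one_mulVec]
      exact sub_eq_iff_eq_add'.mpr heq
    rw [← hsolve, mulVec_mulVec, Matrix.nonsing_inv_mul _ hinv, one_mulVec]
  refine ⟨hderiv, fun hnM hrank => ?_⟩
  rw [LinearMap.range_eq_top.mpr, finrank_top, Module.finrank_fin_fun]
  intro y
  obtain ⟨d, hd⟩ := exists_sum_pow_mul_mulVec_eq hnM hrank
    (((1 : Matrix (Fin n) (Fin n) ℝ) - A ^ M) *ᵥ y)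
  refine ⟨d, ?_⟩
  rw [ContinuousLinearMap.coe_coe, hderiv, hd, mulVec_mulVec, Matrix.nonsing_inv_mul _ hinv,
    one_mulVec]
end

section
/- Let λ ∈ (0,1), let M ≥ 1 be an integer, let α > 0, and let (Q_i)_{i≥0} be a sequence of symmetric positive semidefinite matrices in ℝ^{S×S} such that Σ_{i=j}^{j+M−1} Q_i ⪰ α I_S for every j ≥ 0. Then for every k ≥ M, the exponentially discounted sum satisfies Σ_{i=0}^{k−1} λ^{k−1−i} Q_i ⪰ α λ^{M−1} I_S ⪰ α (λ^{-1} − 1)/(λ^{-(M+1)} − 1) · I_S; in particular this discounted sum is positive definite with a lower bound independent of k. -/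
open Matrix

/-- lower bound on exponentially discounted excitation sums.
If positive semidefinite matrices `Q_i` satisfy the persistence-of-excitation
lower bound `Σ_{i=j}^{j+M−1} Q_i ⪰ α I` for every window start `j`, then for
every `k ≥ M` the discounted sum `Σ_{i=0}^{k−1} λ^{k−1−i} Q_i` is bounded
below by `α λ^{M−1} I`, which in turn dominates
`α (λ⁻¹ − 1)/(λ^{−(M+1)} − 1) · I`. -/
theorem discounted_excitation_lower_bound
    {S : ℕ} (l : ℝ) (hl0 : 0 < l) (hl1 : l < 1)
    (M : ℕ) (hM : 1 ≤ M) (α : ℝ) (hα : 0 < α)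
    (Q : ℕ → Matrix (Fin S) (Fin S) ℝ)
    (hQ : ∀ i, (Q i).PosSemidef)
    (hPE : ∀ j : ℕ,
      (∑ i ∈ Finset.Ico j (j + M), Q i - α • (1 : Matrix (Fin S) (Fin S) ℝ)).PosSemidef) :
    (∀ k, M ≤ k →
      (∑ i ∈ Finset.range k, l ^ (k - 1 - i) • Q i -
        (α * l ^ (M - 1)) • (1 : Matrix (Fin S) (Fin S) ℝ)).PosSemidef) ∧
    α * (l⁻¹ - 1) / ((l ^ (M + 1))⁻¹ - 1) ≤ α * l ^ (M - 1) := by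
  refine ⟨fun k hk => ?_, ?_⟩
  · obtain ⟨m, rfl⟩ := Nat.exists_eq_add_of_le' hk
    have hsplit : ∑ i ∈ Finset.range (m + M), l ^ (m + M - 1 - i) • Q i -
          (α * l ^ (M - 1)) • (1 : Matrix (Fin S) (Fin S) ℝ) =
        ∑ i ∈ Finset.range m, l ^ (m + M - 1 - i) • Q i +
          ∑ i ∈ Finset.Ico m (m + M), (l ^ (m + M - 1 - i) - l ^ (M - 1)) • Q i +
          l ^ (M - 1) • (∑ i ∈ Finset.Ico m (m + M), Q i - α • 1) := by
      rw [← Finset.sum_range_add_sum_Ico _ (Nat.le_add_right m M)]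
      simp only [sub_smul, Finset.sum_sub_distrib, smul_sub, Finset.smul_sum, smul_smul,
        mul_comm α]
      abel
    rw [hsplit]
    refine ((posSemidef_sum _ fun i _ => (hQ i).smul (pow_nonneg hl0.le _)).add
      (posSemidef_sum _ fun i hi => (hQ i).smul ?_)).add ((hPE m).smul (pow_nonneg hl0.le _))
    have hi := Finset.mem_Ico.mp hi
    exact sub_nonneg.mpr (pow_le_pow_of_le_one hl0.le hl1.le (by omega))
  · obtain ⟨n, rfl⟩ := Nat.exists_eq_add_of_le' hM
    have hpow : l ^ (n + 1 + 1) < 1 := pow_lt_one₀ hl0.le hl1 (by omega)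
    have hle : l ^ (n + 1 + 1) ≤ l ^ 2 := pow_le_pow_of_le_one hl0.le hl1.le (by omega)
    have hden : 0 < (l ^ (n + 1 + 1))⁻¹ - 1 :=
      sub_pos.mpr ((one_lt_inv₀ (by positivity)).mpr hpow)
    rw [div_le_iff₀ hden, mul_assoc]
    refine mul_le_mul_of_nonneg_left ?_ hα.le
    have hrhs : l ^ (n + 1 - 1) * ((l ^ (n + 1 + 1))⁻¹ - 1) =
        (l ^ 2)⁻¹ * (1 - l ^ (n + 1 + 1)) := by
      rw [Nat.add_sub_cancel]
      field_simp
      ring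
    have hlhs : l⁻¹ - 1 = (l ^ 2)⁻¹ * (l - l ^ 2) := by field_simp
    rw [hrhs, hlhs]
    exact mul_le_mul_of_nonneg_left (by linarith) (by positivity)
end

section
/- Let λ > 0, let P ∈ ℝ^{S×S} and T ∈ ℝ^{n×n} be symmetric positive definite, and let φ ∈ ℝ^{S×n}. Define D = λT + φᵀPφ and F = I_S − Pφ D^{-1} φᵀ. Then the exact algebraic identity Fᵀ (λ P^{-1} + φ T^{-1} φᵀ) F = λ (P^{-1} − φ D^{-1} φᵀ) holds; equivalently, Fᵀ (λ P^{-1} + φ T^{-1} φᵀ) F − P^{-1} = (λ − 1) P^{-1} − λ φ D^{-1} φᵀ. -/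
open Matrix

/-- A form of the Woodbury identity: with `D = l • T + φᵀ * P * φ`, right multiplication by
`1 - P * φ * D⁻¹ * φᵀ` turns `l • P⁻¹ + φ * T⁻¹ * φᵀ` into `l • P⁻¹`. -/
theorem Matrix.smul_inv_add_mul_one_sub_mul_inv {m n R : Type*} [Fintype m] [DecidableEq m]
    [Fintype n] [DecidableEq n] [CommRing R] (l : R) {P : Matrix m m R} {T D : Matrix n n R}
    (φ : Matrix m n R) (hP : IsUnit P.det) (hT : IsUnit T.det) (hDu : IsUnit D.det)
    (hD : D = l • T + φᵀ * P * φ) :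
    (l • P⁻¹ + φ * T⁻¹ * φᵀ) * (1 - P * φ * D⁻¹ * φᵀ) = l • P⁻¹ := by
  have hP' : P⁻¹ * (P * φ * D⁻¹ * φᵀ) = φ * D⁻¹ * φᵀ := by
    simp only [Matrix.mul_assoc, Matrix.nonsing_inv_mul_cancel_left _ _ hP]
  have hT' : φ * T⁻¹ * φᵀ * (P * φ * D⁻¹ * φᵀ) = φ * T⁻¹ * φᵀ - l • (φ * D⁻¹ * φᵀ) := by
    calc φ * T⁻¹ * φᵀ * (P * φ * D⁻¹ * φᵀ)
        = φ * (T⁻¹ * ((φᵀ * P * φ) * (D⁻¹ * φᵀ))) := by simp only [Matrix.mul_assoc]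
      _ = φ * (T⁻¹ * ((D - l • T) * (D⁻¹ * φᵀ))) := by rw [eq_sub_of_add_eq' hD.symm]
      _ = φ * T⁻¹ * φᵀ - l • (φ * D⁻¹ * φᵀ) := by
        simp only [Matrix.sub_mul, Matrix.mul_sub, Matrix.smul_mul, Matrix.mul_smul,
          Matrix.mul_nonsing_inv_cancel_left _ _ hDu,
          Matrix.nonsing_inv_mul_cancel_left _ _ hT, Matrix.mul_assoc]
  rw [Matrix.mul_sub, Matrix.mul_one, Matrix.add_mul, Matrix.smul_mul, hP', hT']
  abel

/-- Lyapunov-difference identity for RLS with forgetting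
factor.  With `D = λT + φᵀPφ` and `F = I − PφD⁻¹φᵀ`, one has
`Fᵀ (λP⁻¹ + φT⁻¹φᵀ) F = λ(P⁻¹ − φD⁻¹φᵀ)`, equivalently
`Fᵀ (λP⁻¹ + φT⁻¹φᵀ) F − P⁻¹ = (λ−1)P⁻¹ − λφD⁻¹φᵀ`. -/
theorem rls_lyapunov_difference_identity
    {S n : ℕ} (l : ℝ) (hl : 0 < l)
    (P : Matrix (Fin S) (Fin S) ℝ) (T : Matrix (Fin n) (Fin n) ℝ)
    (hP : P.PosDef) (hT : T.PosDef)
    (φ : Matrix (Fin S) (Fin n) ℝ)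
    (D : Matrix (Fin n) (Fin n) ℝ) (hD : D = l • T + φᵀ * P * φ)
    (F : Matrix (Fin S) (Fin S) ℝ)
    (hF : F = (1 : Matrix (Fin S) (Fin S) ℝ) - P * φ * D⁻¹ * φᵀ) :
    Fᵀ * (l • P⁻¹ + φ * T⁻¹ * φᵀ) * F = l • (P⁻¹ - φ * D⁻¹ * φᵀ) ∧
    Fᵀ * (l • P⁻¹ + φ * T⁻¹ * φᵀ) * F - P⁻¹ =
      (l - 1) • P⁻¹ - l • (φ * D⁻¹ * φᵀ) := by
  have hDpos : D.PosDef := by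
    rw [hD, ← conjTranspose_eq_transpose_of_trivial]
    exact (hT.smul hl).add_posSemidef (hP.posSemidef.conjTranspose_mul_mul_same φ)
  have hPu : IsUnit P.det := hP.det_pos.ne'.isUnit
  have hPt : Pᵀ = P := by simpa using hP.isHermitian.eq
  have hDt : Dᵀ = D := by simpa using hDpos.isHermitian.eq
  have key : Fᵀ * (l • P⁻¹ + φ * T⁻¹ * φᵀ) * F = l • (P⁻¹ - φ * D⁻¹ * φᵀ) := by
    rw [Matrix.mul_assoc, hF, smul_inv_add_mul_one_sub_mul_inv l φ hPu
      hT.det_pos.ne'.isUnit hDpos.det_pos.ne'.isUnit hD]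
    simp only [transpose_sub, transpose_one, transpose_mul, transpose_transpose,
      transpose_nonsing_inv, hPt, hDt, Matrix.mul_smul, Matrix.sub_mul, Matrix.one_mul,
      Matrix.mul_assoc, mul_nonsing_inv _ hPu, Matrix.mul_one]
  refine ⟨key, ?_⟩
  rw [key, smul_sub, sub_smul, one_smul]
  abel
end

section
/- Let λ ∈ (0,1), let T ∈ ℝ^{n×n} and P_{-1} ∈ ℝ^{S×S} be symmetric positive definite, let θ, θ̂_0 ∈ ℝ^S, and let φ_k ∈ ℝ^{S×n} (k ≥ 0) be arbitrary. Run recursive least squares with forgetting factor on noise-free data x̃_{k+1} = φ_kᵀ θ: define D_k = λT + φ_kᵀ P_{k-1} φ_k, θ̂_{k+1} = θ̂_k + P_{k-1} φ_k D_k^{-1}(x̃_{k+1} − φ_kᵀ θ̂_k), P_k = λ^{-1}(I_S − P_{k-1} φ_k D_k^{-1} φ_kᵀ) P_{k-1}. Then the estimation error θ̃_k = θ − θ̂_k satisfies θ̃_{k+1} = (I_S − P_{k-1} φ_k D_k^{-1} φ_kᵀ) θ̃_k, and the Lyapunov function W_k = θ̃_kᵀ P_{k-1}^{-1} θ̃_k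 satisfies W_{k+1} ≤ λ W_k for all k ≥ 0; consequently W_k ≤ λ^k θ̃_0ᵀ P_{-1}^{-1} θ̃_0 for all k ≥ 0. -/
open Matrix

/-- The covariance update of recursive least squares, before rescaling, preserves positive
definiteness. -/
theorem posDef_covariance_update {m n : Type*} [Fintype m] [DecidableEq m] [Fintype n]
    [DecidableEq n] {P : Matrix m m ℝ} {R : Matrix n n ℝ} (hP : P.PosDef) (hR : R.PosDef)
    (φ : Matrix m n ℝ) :
    ((1 - P * φ * (R + φᵀ * P * φ)⁻¹ * φᵀ) * P).PosDef := by
  have hQ : (P⁻¹ + φ * R⁻¹ * φᵀ).PosDef := by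
    have h := hR.inv.posSemidef.mul_mul_conjTranspose_same φ
    rw [conjTranspose_eq_transpose_of_trivial] at h
    exact hP.inv.add_posSemidef h
  have hPdet : IsUnit P.det := (isUnit_iff_isUnit_det P).1 hP.isUnit
  have hRdet : IsUnit R.det := (isUnit_iff_isUnit_det R).1 hR.isUnit
  have hD : (R + φᵀ * P * φ).PosDef := by
    have h := hP.posSemidef.conjTranspose_mul_mul_same φ
    rw [conjTranspose_eq_transpose_of_trivial] at h
    exact hR.add_posSemidef h
  have hW := add_mul_mul_inv_eq_sub P⁻¹ φ R⁻¹ φᵀ hP.inv.isUnit hR.inv.isUnit (by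
    simpa only [nonsing_inv_nonsing_inv _ hPdet, nonsing_inv_nonsing_inv _ hRdet] using hD.isUnit)
  rw [nonsing_inv_nonsing_inv _ hPdet, nonsing_inv_nonsing_inv _ hRdet] at hW
  rw [Matrix.sub_mul, Matrix.one_mul, ← hW]
  exact hQ.inv

/-- With `M = 1 - P φ D⁻¹ φᵀ`, the quadratic form of `(l⁻¹ M P)⁻¹` at `M e` is at most `l` times
the quadratic form of `P⁻¹` at `e`. -/
theorem dotProduct_inv_covariance_update_le {m n : Type*} [Fintype m] [DecidableEq m] [Fintype n]
    [DecidableEq n] {P : Matrix m m ℝ} {D : Matrix n n ℝ} {φ : Matrix m n ℝ} {l : ℝ} (hl : 0 < l)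
    (hP : P.PosDef) (hD : D.PosDef) (hMP : ((1 - P * φ * D⁻¹ * φᵀ) * P).PosDef) (e : m → ℝ) :
    ((1 - P * φ * D⁻¹ * φᵀ) *ᵥ e) ⬝ᵥ (l⁻¹ • ((1 - P * φ * D⁻¹ * φᵀ) * P))⁻¹ *ᵥ
        ((1 - P * φ * D⁻¹ * φᵀ) *ᵥ e) ≤ l * (e ⬝ᵥ P⁻¹ *ᵥ e) := by
  have hPdet : IsUnit P.det := (isUnit_iff_isUnit_det P).1 hP.isUnit
  set M := 1 - P * φ * D⁻¹ * φᵀ with hM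
  have hP' : (l⁻¹ • (M * P)).PosDef := hMP.smul (inv_pos.2 hl)
  have hdet' : IsUnit (l⁻¹ • (M * P)).det := (isUnit_iff_isUnit_det _).1 hP'.isUnit
  have hfac : M *ᵥ e = (l⁻¹ • (M * P)) *ᵥ (l • P⁻¹ *ᵥ e) := by
    rw [mulVec_smul, smul_mulVec, smul_smul, mul_inv_cancel₀ hl.ne', one_smul, mulVec_mulVec,
      Matrix.mul_assoc, mul_nonsing_inv _ hPdet, Matrix.mul_one]
  have hinv : (l⁻¹ • (M * P))⁻¹ *ᵥ (M *ᵥ e) = l • P⁻¹ *ᵥ e := by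
    rw [hfac, mulVec_mulVec, nonsing_inv_mul _ hdet', one_mulVec]
  have hsymm : Pᵀ = P := by
    simpa only [conjTranspose_eq_transpose_of_trivial] using hP.isHermitian.eq
  have hquad : (M *ᵥ e) ⬝ᵥ P⁻¹ *ᵥ e =
      e ⬝ᵥ P⁻¹ *ᵥ e - (φᵀ *ᵥ e) ⬝ᵥ D⁻¹ *ᵥ (φᵀ *ᵥ e) := by
    have hcross : (P *ᵥ (φ *ᵥ (D⁻¹ *ᵥ (φᵀ *ᵥ e)))) ⬝ᵥ P⁻¹ *ᵥ e =
        (φᵀ *ᵥ e) ⬝ᵥ D⁻¹ *ᵥ (φᵀ *ᵥ e) := by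
      rw [dotProduct_comm, dotProduct_mulVec, ← mulVec_transpose, hsymm, mulVec_mulVec,
        mul_nonsing_inv _ hPdet, one_mulVec, dotProduct_mulVec, ← mulVec_transpose]
    rw [hM, sub_mulVec, one_mulVec, sub_dotProduct, ← hcross]
    simp only [mulVec_mulVec, Matrix.mul_assoc]
  have hnonneg : 0 ≤ (φᵀ *ᵥ e) ⬝ᵥ D⁻¹ *ᵥ (φᵀ *ᵥ e) := by
    simpa using hD.inv.posSemidef.dotProduct_mulVec_nonneg (φᵀ *ᵥ e)
  rw [hinv, dotProduct_smul, smul_eq_mul, hquad]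
  exact mul_le_mul_of_nonneg_left (sub_le_self _ hnonneg) hl.le

/-- noise-free RLS: error recursion and Lyapunov decrease.
Here `P k` plays the role of `P_{k-1}` of the paper, so `P 0` is the initial
covariance `P_{-1}` and `W_k = θ̃_kᵀ P_{k-1}⁻¹ θ̃_k` becomes
`(θ − θ̂ k) ⬝ᵥ (P k)⁻¹ *ᵥ (θ − θ̂ k)`.  With noise-free data
`x̃_{k+1} = φ_kᵀ θ` the estimation error satisfies
`θ̃_{k+1} = (I − P_{k-1}φ_k D_k⁻¹ φ_kᵀ) θ̃_k`, and `W_{k+1} ≤ λ W_k`, hence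
`W_k ≤ λᵏ θ̃_0ᵀ P_{-1}⁻¹ θ̃_0`. -/
theorem rls_noise_free_lyapunov_decrease
    {S n : ℕ} (l : ℝ) (hl0 : 0 < l) (hl1 : l < 1)
    (T : Matrix (Fin n) (Fin n) ℝ) (hT : T.PosDef)
    (P : ℕ → Matrix (Fin S) (Fin S) ℝ) (hP0 : (P 0).PosDef)
    (θ : Fin S → ℝ) (θhat : ℕ → (Fin S → ℝ))
    (φ : ℕ → Matrix (Fin S) (Fin n) ℝ) (xt : ℕ → (Fin n → ℝ))
    (hdata : ∀ k, xt (k + 1) = (φ k)ᵀ *ᵥ θ)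
    (D : ℕ → Matrix (Fin n) (Fin n) ℝ)
    (hD : ∀ k, D k = l • T + (φ k)ᵀ * P k * φ k)
    (hθ : ∀ k, θhat (k + 1) =
      θhat k + (P k * φ k * (D k)⁻¹) *ᵥ (xt (k + 1) - (φ k)ᵀ *ᵥ θhat k))
    (hPrec : ∀ k, P (k + 1) =
      l⁻¹ • (((1 : Matrix (Fin S) (Fin S) ℝ) -
        P k * φ k * (D k)⁻¹ * (φ k)ᵀ) * P k)) :
    (∀ k, θ - θhat (k + 1) =
      ((1 : Matrix (Fin S) (Fin S) ℝ) - P k * φ k * (D k)⁻¹ * (φ k)ᵀ) *ᵥ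
        (θ - θhat k)) ∧
    (∀ k, (θ - θhat (k + 1)) ⬝ᵥ (P (k + 1))⁻¹ *ᵥ (θ - θhat (k + 1)) ≤
      l * ((θ - θhat k) ⬝ᵥ (P k)⁻¹ *ᵥ (θ - θhat k))) ∧
    (∀ k, (θ - θhat k) ⬝ᵥ (P k)⁻¹ *ᵥ (θ - θhat k) ≤
      l ^ k * ((θ - θhat 0) ⬝ᵥ (P 0)⁻¹ *ᵥ (θ - θhat 0))) := by
  have hDpos (k : ℕ) (hk : (P k).PosDef) : (D k).PosDef := by
    have h := hk.posSemidef.conjTranspose_mul_mul_same (φ k)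
    rw [conjTranspose_eq_transpose_of_trivial] at h
    rw [hD k]
    exact (hT.smul hl0).add_posSemidef h
  have hMP (k : ℕ) (hk : (P k).PosDef) :
      ((1 - P k * φ k * (D k)⁻¹ * (φ k)ᵀ) * P k).PosDef := by
    rw [hD k]
    exact posDef_covariance_update hk (hT.smul hl0) (φ k)
  have hP (k : ℕ) : (P k).PosDef := by
    induction k with
    | zero => exact hP0
    | succ k ih =>
      rw [hPrec k]
      exact (hMP k ih).smul (inv_pos.2 hl0)
  have herr (k : ℕ) : θ - θhat (k + 1) =
      (1 - P k * φ k * (D k)⁻¹ * (φ k)ᵀ) *ᵥ (θ - θhat k) := by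
    rw [hθ k, hdata k, ← mulVec_sub, mulVec_mulVec, sub_mulVec, one_mulVec, sub_add_eq_sub_sub]
  have hdec (k : ℕ) : (θ - θhat (k + 1)) ⬝ᵥ (P (k + 1))⁻¹ *ᵥ (θ - θhat (k + 1)) ≤
      l * ((θ - θhat k) ⬝ᵥ (P k)⁻¹ *ᵥ (θ - θhat k)) := by
    rw [herr k, hPrec k]
    exact dotProduct_inv_covariance_update_le hl0 (hP k) (hDpos k (hP k)) (hMP k (hP k)) _
  refine ⟨herr, hdec, fun k => ?_⟩
  induction k with
  | zero => simp
  | succ k ih =>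
    rw [pow_succ', mul_assoc]
    exact (hdec k).trans (mul_le_mul_of_nonneg_left ih hl0.le)
end

section
/- Let λ ∈ (0,1), let T ∈ ℝ^{n×n} and P_{-1} ∈ ℝ^{S×S} be symmetric positive definite, let θ, θ̂_0 ∈ ℝ^S, and let the regressor sequence φ_k ∈ ℝ^{S×n} be persistently exciting with window M and lower constant α > 0, i.e. Σ_{i=j}^{j+M−1} φ_i φ_iᵀ ⪰ α I_S for all j ≥ 0. Run recursive least squares with forgetting factor on noise-free data x̃_{k+1} = φ_kᵀ θ (recursions D_k = λT + φ_kᵀP_{k-1}φ_k, θ̂_{k+1} = θ̂_k + P_{k-1}φ_k D_k^{-1}(x̃_{k+1} − φ_kᵀθ̂_k), P_k = λ^{-1}(I − P_{k-1}φ_k D_k^{-1}φ_kᵀ)P_{k-1}). Then the estimation error θ̃_k = θ − θ̂_k converges exponentially: |θ̃_k|² ≤ γ_F λ^k |θ̃_0|² for all k ≥ M, with the explicit constant γ_F = [(λ^{-(M+1)} − 1) / (λ_min(T^{-1}) α (λ^{-1} − 1))] · λ_max(P_{-1}^{-1}). -/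
open Matrix

open scoped MatrixOrder in
theorem Matrix.IsHermitian.iInf_eigenvalues_mul_le {m : Type*} [Fintype m] [DecidableEq m]
    {A : Matrix m m ℝ} (hA : A.IsHermitian) (x : m → ℝ) :
    (⨅ i, hA.eigenvalues i) * (x ⬝ᵥ x) ≤ x ⬝ᵥ A *ᵥ x := by
  have h : algebraMap ℝ (Matrix m m ℝ) (⨅ i, hA.eigenvalues i) ≤ A := by
    rw [algebraMap_le_iff_le_spectrum (ha := hA), hA.spectrum_real_eq_range_eigenvalues]
    rintro _ ⟨i, rfl⟩
    exact ciInf_le (Set.finite_range _).bddBelow i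
  have := (Matrix.le_iff.1 h).dotProduct_mulVec_nonneg x
  simpa [sub_mulVec, dotProduct_sub, Algebra.algebraMap_eq_smul_one, smul_mulVec] using this

open scoped MatrixOrder in
theorem Matrix.IsHermitian.le_iSup_eigenvalues_mul {m : Type*} [Fintype m] [DecidableEq m]
    {A : Matrix m m ℝ} (hA : A.IsHermitian) (x : m → ℝ) :
    x ⬝ᵥ A *ᵥ x ≤ (⨆ i, hA.eigenvalues i) * (x ⬝ᵥ x) := by
  have h : A ≤ algebraMap ℝ (Matrix m m ℝ) (⨆ i, hA.eigenvalues i) := by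
    rw [le_algebraMap_iff_spectrum_le (ha := hA), hA.spectrum_real_eq_range_eigenvalues]
    rintro _ ⟨i, rfl⟩
    exact le_ciSup (Set.finite_range _).bddAbove i
  have := (Matrix.le_iff.1 h).dotProduct_mulVec_nonneg x
  simpa [sub_mulVec, dotProduct_sub, Algebra.algebraMap_eq_smul_one, smul_mulVec] using this

section RLSStep

variable {m n : Type*} [Fintype m] [Fintype n]
  {l : ℝ} {T D : Matrix n n ℝ} {P : Matrix m m ℝ} {φ : Matrix m n ℝ}

theorem rls_innovation_posDef (hl : 0 < l) (hT : T.PosDef) (hP : P.PosDef)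
    (hD : D = l • T + φᵀ * P * φ) : D.PosDef := by
  rw [hD]
  exact (hT.smul hl).add_posSemidef (by simpa using hP.posSemidef.conjTranspose_mul_mul_same φ)

variable [DecidableEq m] [DecidableEq n]

theorem rls_information_posDef (hl : 0 < l) (hT : T.PosDef) (hP : P.PosDef) :
    (l • P⁻¹ + φ * T⁻¹ * φᵀ).PosDef :=
  (hP.inv.smul hl).add_posSemidef
    (by simpa using hT.inv.posSemidef.mul_mul_conjTranspose_same φ)

theorem rls_information_mul_transition (hl : 0 < l) (hT : T.PosDef) (hP : P.PosDef)
    (hD : D = l • T + φᵀ * P * φ) :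
    (l • P⁻¹ + φ * T⁻¹ * φᵀ) * (1 - P * φ * D⁻¹ * φᵀ) = l • P⁻¹ := by
  have hDu := (rls_innovation_posDef hl hT hP hD).isUnit
  have hPP : P⁻¹ * P = 1 := nonsing_inv_mul _ ((isUnit_iff_isUnit_det _).1 hP.isUnit)
  have hTT : T⁻¹ * T = 1 := nonsing_inv_mul _ ((isUnit_iff_isUnit_det _).1 hT.isUnit)
  have hDD : D * D⁻¹ = 1 := mul_nonsing_inv _ ((isUnit_iff_isUnit_det _).1 hDu)
  have hφ : φᵀ * P * φ = D - l • T := by rw [hD]; abel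
  have h₁ : P⁻¹ * (P * φ * D⁻¹ * φᵀ) = φ * D⁻¹ * φᵀ := by
    simp only [← Matrix.mul_assoc, hPP, Matrix.one_mul]
  have h₂ : φ * T⁻¹ * φᵀ * (P * φ * D⁻¹ * φᵀ) = φ * T⁻¹ * φᵀ - l • (φ * D⁻¹ * φᵀ) := by
    calc φ * T⁻¹ * φᵀ * (P * φ * D⁻¹ * φᵀ)
        = φ * T⁻¹ * (φᵀ * P * φ) * D⁻¹ * φᵀ := by simp only [Matrix.mul_assoc]
      _ = φ * T⁻¹ * (D * D⁻¹) * φᵀ - l • (φ * (T⁻¹ * T) * D⁻¹ * φᵀ) := by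
        rw [hφ]
        simp only [Matrix.mul_sub, Matrix.sub_mul, Matrix.mul_smul, Matrix.smul_mul,
          Matrix.mul_assoc]
      _ = _ := by simp only [hDD, hTT, Matrix.mul_one]
  rw [Matrix.mul_sub, Matrix.mul_one, Matrix.add_mul, Matrix.smul_mul, h₁, h₂]
  abel

theorem rls_covariance_inv (hl : 0 < l) (hT : T.PosDef) (hP : P.PosDef)
    (hD : D = l • T + φᵀ * P * φ) :
    l⁻¹ • ((1 - P * φ * D⁻¹ * φᵀ) * P) = (l • P⁻¹ + φ * T⁻¹ * φᵀ)⁻¹ := by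
  have hPP : P⁻¹ * P = 1 := nonsing_inv_mul _ ((isUnit_iff_isUnit_det _).1 hP.isUnit)
  refine (inv_eq_right_inv ?_).symm
  rw [Matrix.mul_smul, ← Matrix.mul_assoc, rls_information_mul_transition hl hT hP hD,
    Matrix.smul_mul, hPP, smul_smul, inv_mul_cancel₀ hl.ne', one_smul]

theorem rls_lyapunov_le (hl : 0 < l) (hT : T.PosDef) (hP : P.PosDef)
    (hD : D = l • T + φᵀ * P * φ) (x : m → ℝ) :
    ((1 - P * φ * D⁻¹ * φᵀ) *ᵥ x) ⬝ᵥ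
        (l • P⁻¹ + φ * T⁻¹ * φᵀ) *ᵥ ((1 - P * φ * D⁻¹ * φᵀ) *ᵥ x) ≤
      l * (x ⬝ᵥ P⁻¹ *ᵥ x) := by
  have hPP : P * P⁻¹ = 1 := mul_nonsing_inv _ ((isUnit_iff_isUnit_det _).1 hP.isUnit)
  have hDp := rls_innovation_posDef hl hT hP hD
  have hPt : Pᵀ = P := by simpa using hP.isHermitian.eq
  have hDt : D⁻¹ᵀ = D⁻¹ := by simpa using hDp.inv.isHermitian.eq
  have hDn := hDp.inv.posSemidef.dotProduct_mulVec_nonneg (φᵀ *ᵥ x)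
  have h : (P * φ * D⁻¹ * φᵀ)ᵀ * P⁻¹ = φ * D⁻¹ * φᵀ := by
    simp only [transpose_mul, transpose_transpose, hPt, hDt, Matrix.mul_assoc, hPP,
      Matrix.mul_one]
  have hx : ((P * φ * D⁻¹ * φᵀ) *ᵥ x) ⬝ᵥ P⁻¹ *ᵥ x = (φᵀ *ᵥ x) ⬝ᵥ D⁻¹ *ᵥ (φᵀ *ᵥ x) := by
    rw [← vecMul_transpose, ← dotProduct_mulVec, mulVec_mulVec, h, ← mulVec_mulVec,
      ← mulVec_mulVec, dotProduct_mulVec, ← mulVec_transpose]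
  rw [star_trivial] at hDn
  rw [mulVec_mulVec, rls_information_mul_transition hl hT hP hD, smul_mulVec, dotProduct_smul,
    smul_eq_mul, sub_mulVec, one_mulVec, sub_dotProduct, hx]
  exact mul_le_mul_of_nonneg_left (by linarith) hl.le

end RLSStep

theorem pow_mul_sum_Ico_le_of_forgetting_recursion {l : ℝ} (hl0 : 0 ≤ l) (hl1 : l ≤ 1)
    {a b : ℕ → ℝ} (ha : ∀ k, 0 ≤ a k) (hb : ∀ k, 0 ≤ b k)
    (hab : ∀ k, a (k + 1) = l * a k + b k) (j m : ℕ) :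
    l ^ m * ∑ i ∈ Finset.Ico j (j + m), b i ≤ l * a (j + m) := by
  induction m with
  | zero => simpa using mul_nonneg hl0 (ha j)
  | succ m ih =>
    rw [← add_assoc, Finset.sum_Ico_succ_top (by lia), hab, pow_succ']
    have h₁ := mul_le_mul_of_nonneg_left ih hl0
    have h₂ : l * l ^ m * b (j + m) ≤ l * b (j + m) := by
      have := mul_le_mul_of_nonneg_left (pow_le_one₀ hl0 hl1 (n := m)) hl0
      exact mul_le_mul_of_nonneg_right (by linarith) (hb _)
    linarith

/-- exponential convergence of noise-free RLS under
persistence of excitation.  Here `P k` plays the role of `P_{k-1}` of the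
paper, so `P 0` is the initial covariance `P_{-1}`, and squared Euclidean
norms are written as dot products.  Under persistence of excitation with
window `M` and constant `α`, the estimation error satisfies
`|θ̃_k|² ≤ γ_F λᵏ |θ̃_0|²` for all `k ≥ M`, with
`γ_F = (λ^{-(M+1)} − 1)/(λ_min(T⁻¹) α (λ⁻¹ − 1)) · λ_max(P_{-1}⁻¹)`. -/
theorem rls_noise_free_exponential_convergence
    {S n : ℕ} (hS : 0 < S) (hn : 0 < n)
    (l : ℝ) (hl0 : 0 < l) (hl1 : l < 1)
    (T : Matrix (Fin n) (Fin n) ℝ) (hT : T.PosDef)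
    (P : ℕ → Matrix (Fin S) (Fin S) ℝ) (hP0 : (P 0).PosDef)
    (θ : Fin S → ℝ) (θhat : ℕ → (Fin S → ℝ))
    (φ : ℕ → Matrix (Fin S) (Fin n) ℝ)
    (M : ℕ) (hM : 1 ≤ M) (α : ℝ) (hα : 0 < α)
    (hPE : ∀ j : ℕ,
      (∑ i ∈ Finset.Ico j (j + M), φ i * (φ i)ᵀ -
        α • (1 : Matrix (Fin S) (Fin S) ℝ)).PosSemidef)
    (xt : ℕ → (Fin n → ℝ))
    (hdata : ∀ k, xt (k + 1) = (φ k)ᵀ *ᵥ θ)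
    (D : ℕ → Matrix (Fin n) (Fin n) ℝ)
    (hD : ∀ k, D k = l • T + (φ k)ᵀ * P k * φ k)
    (hθ : ∀ k, θhat (k + 1) =
      θhat k + (P k * φ k * (D k)⁻¹) *ᵥ (xt (k + 1) - (φ k)ᵀ *ᵥ θhat k))
    (hPrec : ∀ k, P (k + 1) =
      l⁻¹ • (((1 : Matrix (Fin S) (Fin S) ℝ) -
        P k * φ k * (D k)⁻¹ * (φ k)ᵀ) * P k)) :
    ∀ k, M ≤ k →
      (θ - θhat k) ⬝ᵥ (θ - θhat k) ≤
        (((l ^ (M + 1))⁻¹ - 1) /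
            ((⨅ i, (hT.1.inv.eigenvalues) i) * α * (l⁻¹ - 1)) *
          (⨆ i, (hP0.1.inv.eigenvalues) i)) *
        l ^ k * ((θ - θhat 0) ⬝ᵥ (θ - θhat 0)) := by
  have hPpos : ∀ k, (P k).PosDef := fun k ↦ by
    induction k with
    | zero => exact hP0
    | succ k ih =>
      rw [hPrec, rls_covariance_inv hl0 hT ih (hD k)]
      exact (rls_information_posDef hl0 hT ih).inv
  have hR : ∀ k, (P (k + 1))⁻¹ = l • (P k)⁻¹ + φ k * T⁻¹ * (φ k)ᵀ := fun k ↦ by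
    rw [hPrec, rls_covariance_inv hl0 hT (hPpos k) (hD k)]
    exact nonsing_inv_nonsing_inv _
      ((isUnit_iff_isUnit_det _).1 (rls_information_posDef hl0 hT (hPpos k)).isUnit)
  have herr : ∀ k, θ - θhat (k + 1) =
      (1 - P k * φ k * (D k)⁻¹ * (φ k)ᵀ) *ᵥ (θ - θhat k) := fun k ↦ by
    rw [hθ, hdata, ← mulVec_sub, mulVec_mulVec, sub_mulVec, one_mulVec]
    abel
  have hV : ∀ k, (θ - θhat k) ⬝ᵥ (P k)⁻¹ *ᵥ (θ - θhat k) ≤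
      l ^ k * ((θ - θhat 0) ⬝ᵥ (P 0)⁻¹ *ᵥ (θ - θhat 0)) := fun k ↦ by
    induction k with
    | zero => simp
    | succ k ih =>
      rw [herr, hR, pow_succ', mul_assoc]
      exact (rls_lyapunov_le hl0 hT (hPpos k) (hD k) _).trans
        (mul_le_mul_of_nonneg_left ih hl0.le)
  intro k hk
  obtain ⟨j, rfl⟩ := Nat.exists_eq_add_of_le' hk
  have hV' := (hV (j + M)).trans (mul_le_mul_of_nonneg_left
    (hP0.1.inv.le_iSup_eigenvalues_mul (θ - θhat 0)) (by positivity))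
  have hmin := hT.1.inv.iInf_eigenvalues_mul_le
  have hμ : 0 < ⨅ i, hT.1.inv.eigenvalues i := by
    have : Nonempty (Fin n) := ⟨⟨0, hn⟩⟩
    obtain ⟨i, hi⟩ := exists_eq_ciInf_of_finite (f := hT.1.inv.eigenvalues)
    rw [← hi]
    exact hT.inv.eigenvalues_pos i
  generalize (⨅ i, hT.1.inv.eigenvalues i) = μ at *
  generalize (⨆ i, hP0.1.inv.eigenvalues i) = ν at *
  generalize θ - θhat 0 = x₀ at *
  generalize θ - θhat (j + M) = x at *
  have hPEx : α * (x ⬝ᵥ x) ≤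
      ∑ i ∈ Finset.Ico j (j + M), ((φ i)ᵀ *ᵥ x) ⬝ᵥ ((φ i)ᵀ *ᵥ x) := by
    have h := (hPE j).dotProduct_mulVec_nonneg x
    simp only [star_trivial, sub_mulVec, smul_mulVec, one_mulVec, dotProduct_sub,
      dotProduct_smul, smul_eq_mul, sum_mulVec, dotProduct_sum, sub_nonneg] at h
    refine h.trans (Finset.sum_le_sum fun i _ ↦ le_of_eq ?_)
    rw [← mulVec_mulVec, dotProduct_mulVec, ← mulVec_transpose]
  have hwin := pow_mul_sum_Ico_le_of_forgetting_recursion hl0.le hl1.le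
    (a := fun k ↦ x ⬝ᵥ (P k)⁻¹ *ᵥ x)
    (b := fun k ↦ ((φ k)ᵀ *ᵥ x) ⬝ᵥ T⁻¹ *ᵥ ((φ k)ᵀ *ᵥ x))
    (fun k ↦ by simpa using (hPpos k).inv.posSemidef.dotProduct_mulVec_nonneg x)
    (fun k ↦ by simpa using hT.inv.posSemidef.dotProduct_mulVec_nonneg ((φ k)ᵀ *ᵥ x))
    (fun k ↦ by
      rw [hR, add_mulVec, smul_mulVec, dotProduct_add, dotProduct_smul, smul_eq_mul,
        ← mulVec_mulVec, ← mulVec_mulVec, dotProduct_mulVec x (φ k), ← mulVec_transpose]) j M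
  have hsum : μ * (α * (x ⬝ᵥ x)) ≤ ∑ i ∈ Finset.Ico j (j + M),
      ((φ i)ᵀ *ᵥ x) ⬝ᵥ T⁻¹ *ᵥ ((φ i)ᵀ *ᵥ x) := by
    refine (mul_le_mul_of_nonneg_left hPEx hμ.le).trans ?_
    rw [Finset.mul_sum]
    exact Finset.sum_le_sum fun i _ ↦ hmin _
  have hlow : l ^ M * (μ * (α * (x ⬝ᵥ x))) ≤ l * (l ^ (j + M) * (ν * (x₀ ⬝ᵥ x₀))) :=
    (mul_le_mul_of_nonneg_left hsum (by positivity)).trans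
      (hwin.trans (mul_le_mul_of_nonneg_left hV' hl0.le))
  have hx : 0 ≤ x ⬝ᵥ x := by simpa using dotProduct_star_self_nonneg x
  have hB : 0 ≤ l ^ (j + M) * (ν * (x₀ ⬝ᵥ x₀)) :=
    nonneg_of_mul_nonneg_right (hlow.trans' (by positivity)) hl0
  have hl : 1 < l⁻¹ := (one_lt_inv₀ hl0).2 hl1
  have hlM : l ^ M ≤ l := pow_le_of_le_one hl0.le hl1.le (by lia)
  rw [mul_assoc, mul_assoc _ ν, mul_left_comm ν, div_mul_eq_mul_div,
    le_div_iff₀ (mul_pos (mul_pos hμ hα) (by linarith))]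
  generalize l ^ (j + M) * (ν * (x₀ ⬝ᵥ x₀)) = B at *
  refine le_of_mul_le_mul_left ?_ (pow_pos hl0 M)
  calc l ^ M * (x ⬝ᵥ x * (μ * α * (l⁻¹ - 1)))
      = l ^ M * (μ * (α * (x ⬝ᵥ x))) * (l⁻¹ - 1) := by ring
    _ ≤ l * B * (l⁻¹ - 1) := mul_le_mul_of_nonneg_right hlow (by linarith)
    _ = (1 - l) * B := by field_simp
    _ ≤ (l⁻¹ - l ^ M) * B := mul_le_mul_of_nonneg_right (by linarith) hB
    _ = l ^ M * (((l ^ (M + 1))⁻¹ - 1) * B) := by rw [pow_succ]; field_simp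
end

section
/- Let λ ∈ (0,1), let T ∈ ℝ^{n×n} and P_{-1} ∈ ℝ^{S×S} be symmetric positive definite, let θ, θ̂_0 ∈ ℝ^S, and let the regressor sequence φ_k ∈ ℝ^{S×n} be persistently exciting with window M and constants 0 < α ≤ β, i.e. α I_S ⪯ Σ_{i=j}^{j+M−1} φ_i φ_iᵀ ⪯ β I_S for all j ≥ 0. Let w_k ∈ ℝ^n be any disturbance sequence with |w_k| ≤ w̄ for all k, and run recursive least squares with forgetting factor on the data x̃_{k+1} = φ_kᵀ θ + w_k. Then there exist constants γ₁, γ₂ > 0, depending only on λ, M, α, β, T and P_{-1}, such that the estimation error θ̃_k = θ − θ̂_k satisfies, for all k ≥ M, |θ̃_k| ≤ γ₁ λ^{k/2} |θ̃_0| + γ₂ · (1 − λ^{k/2})/(1 − λ^{1/2}) · w̄. In particular, θ̃_k converges exponentially to the ball of radius γ₂ w̄ / (1 − λ^{1/2}) centered at the origin. -/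
open Matrix

namespace RLS

lemma dotProduct_self_eq_norm_sq {m : ℕ} (v : Fin m → ℝ) :
    v ⬝ᵥ v = ‖WithLp.toLp 2 v‖ ^ 2 := by
  rw [EuclideanSpace.real_norm_sq_eq]
  simp [dotProduct, sq]

lemma sqrt_dotProduct_self {m : ℕ} (v : Fin m → ℝ) :
    Real.sqrt (v ⬝ᵥ v) = ‖WithLp.toLp 2 v‖ := by
  rw [dotProduct_self_eq_norm_sq, Real.sqrt_sq (norm_nonneg _)]

lemma dotProduct_le_norm_mul_norm {m : ℕ} (v u : Fin m → ℝ) :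
    v ⬝ᵥ u ≤ ‖WithLp.toLp 2 v‖ * ‖WithLp.toLp 2 u‖ := by
  have h := real_inner_le_norm (WithLp.toLp 2 u : EuclideanSpace ℝ (Fin m)) (WithLp.toLp 2 v)
  rw [EuclideanSpace.inner_toLp_toLp] at h
  simpa [mul_comm] using h

lemma exists_norm_mulVec_le {m p : ℕ} (A : Matrix (Fin m) (Fin p) ℝ) :
    ∃ C : ℝ, 0 < C ∧ ∀ v, ‖WithLp.toLp 2 (A *ᵥ v)‖ ≤ C * ‖WithLp.toLp 2 v‖ := by
  let f := LinearMap.toContinuousLinearMap (Matrix.toEuclideanLin A)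
  refine ⟨‖f‖ + 1, by positivity, fun v => ?_⟩
  calc ‖WithLp.toLp 2 (A *ᵥ v)‖ ≤ ‖f‖ * ‖WithLp.toLp 2 v‖ := f.le_opNorm (WithLp.toLp 2 v)
    _ ≤ _ := by gcongr; linarith

/-- A positive definite quadratic form is coercive. -/
lemma PosDef.exists_norm_sq_le {m : ℕ} {A : Matrix (Fin m) (Fin m) ℝ} (hA : A.PosDef) :
    ∃ c : ℝ, 0 < c ∧ ∀ v, c * ‖WithLp.toLp 2 v‖ ^ 2 ≤ v ⬝ᵥ (A *ᵥ v) := by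
  have hcont : Continuous fun x : EuclideanSpace ℝ (Fin m) => x.ofLp ⬝ᵥ (A *ᵥ x.ofLp) := by
    fun_prop
  rcases (Metric.sphere (0 : EuclideanSpace ℝ (Fin m)) 1).eq_empty_or_nonempty with he | hne
  · refine ⟨1, one_pos, fun v => ?_⟩
    have hv : v = 0 := by
      by_contra hv
      have hv' : (WithLp.toLp 2 v : EuclideanSpace ℝ (Fin m)) ≠ 0 := by simpa using hv
      have hmem : ‖(WithLp.toLp 2 v : EuclideanSpace ℝ (Fin m))‖⁻¹ • WithLp.toLp 2 v ∈
          Metric.sphere (0 : EuclideanSpace ℝ (Fin m)) 1 := by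
        simp [norm_smul, hv]
      simp [he] at hmem
    simp [hv]
  · obtain ⟨x, hx, hmin⟩ := (isCompact_sphere _ _).exists_isMinOn hne hcont.continuousOn
    have hx0 : x.ofLp ≠ 0 := by
      rintro h0
      have : x = 0 := by ext i; simp [h0]
      simp [this] at hx
    refine ⟨x.ofLp ⬝ᵥ (A *ᵥ x.ofLp), by simpa using hA.dotProduct_mulVec_pos hx0, fun v => ?_⟩
    by_cases hv : v = 0
    · simp [hv]
    have hv' : 0 < ‖(WithLp.toLp 2 v : EuclideanSpace ℝ (Fin m))‖ := by simpa using hv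
    have hmem : ‖(WithLp.toLp 2 v : EuclideanSpace ℝ (Fin m))‖⁻¹ • WithLp.toLp 2 v ∈
        Metric.sphere (0 : EuclideanSpace ℝ (Fin m)) 1 := by
      simp [norm_smul, hv]
    have h := isMinOn_iff.1 hmin _ hmem
    simp only [WithLp.ofLp_smul, mulVec_smul, dotProduct_smul, smul_dotProduct, smul_eq_mul] at h
    rw [← mul_assoc, ← mul_inv, inv_mul_eq_div, le_div_iff₀ (by positivity)] at h
    rw [sq]
    exact h

/-- The information matrix `P⁻¹` of recursive least squares with forgetting factor `l`. -/
noncomputable def infoMatrix {S n : ℕ} (l : ℝ) (T : Matrix (Fin n) (Fin n) ℝ)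
    (R₀ : Matrix (Fin S) (Fin S) ℝ) (φ : ℕ → Matrix (Fin S) (Fin n) ℝ) :
    ℕ → Matrix (Fin S) (Fin S) ℝ
  | 0 => R₀
  | k + 1 => l • infoMatrix l T R₀ φ k + φ k * T⁻¹ * (φ k)ᵀ

section Information

variable {S n : ℕ} {l : ℝ} {T : Matrix (Fin n) (Fin n) ℝ} {R₀ : Matrix (Fin S) (Fin S) ℝ}
  {φ : ℕ → Matrix (Fin S) (Fin n) ℝ}

lemma infoMatrix_posDef (hl : 0 < l) (hT : T.PosDef) (hR : R₀.PosDef) (k : ℕ) :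
    (infoMatrix l T R₀ φ k).PosDef := by
  induction k with
  | zero => exact hR
  | succ k ih =>
    refine (ih.smul hl).add_posSemidef ?_
    simpa using hT.inv.posSemidef.mul_mul_conjTranspose_same (φ k)

lemma info_mul_gain {R P : Matrix (Fin S) (Fin S) ℝ} {D : Matrix (Fin n) (Fin n) ℝ}
    {ψ : Matrix (Fin S) (Fin n) ℝ} (hT : IsUnit T.det) (hRP : R * P = 1)
    (hD : D = l • T + ψᵀ * P * ψ) (hDu : IsUnit D.det) :
    (l • R + ψ * T⁻¹ * ψᵀ) * (P * ψ * D⁻¹) = ψ * T⁻¹ := by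
  have h : (l • R + ψ * T⁻¹ * ψᵀ) * (P * ψ) = ψ * T⁻¹ * D := by
    have h1 : ψᵀ * P * ψ = D - l • T := by rw [hD]; abel
    calc (l • R + ψ * T⁻¹ * ψᵀ) * (P * ψ)
        = l • (R * P * ψ) + ψ * T⁻¹ * (ψᵀ * P * ψ) := by
          simp only [Matrix.add_mul, Matrix.smul_mul, Matrix.mul_assoc]
      _ = l • ψ + (ψ * T⁻¹ * D - l • (ψ * (T⁻¹ * T))) := by
          rw [h1, hRP, Matrix.one_mul, Matrix.mul_sub, Matrix.mul_smul, Matrix.mul_assoc ψ T⁻¹ T]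
      _ = ψ * T⁻¹ * D := by rw [nonsing_inv_mul _ hT, Matrix.mul_one]; abel
  rw [← Matrix.mul_assoc, h, Matrix.mul_assoc, mul_nonsing_inv _ hDu, Matrix.mul_one]

lemma denominator_posDef (hl : 0 < l) (hT : T.PosDef) {R P : Matrix (Fin S) (Fin S) ℝ}
    (hR : R.PosDef) (hRP : R * P = 1) (ψ : Matrix (Fin S) (Fin n) ℝ) :
    (l • T + ψᵀ * P * ψ).PosDef := by
  refine (hT.smul hl).add_posSemidef ?_
  rw [← inv_eq_right_inv hRP]
  simpa using hR.inv.posSemidef.conjTranspose_mul_mul_same ψ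

lemma infoMatrix_mul_covariance {P : ℕ → Matrix (Fin S) (Fin S) ℝ}
    {D : ℕ → Matrix (Fin n) (Fin n) ℝ} (hl : 0 < l) (hT : T.PosDef) (hR : R₀.PosDef)
    (hP0 : R₀ * P 0 = 1) (hD : ∀ k, D k = l • T + (φ k)ᵀ * P k * φ k)
    (hP : ∀ k, P (k + 1) = l⁻¹ • ((1 - P k * φ k * (D k)⁻¹ * (φ k)ᵀ) * P k)) (k : ℕ) :
    infoMatrix l T R₀ φ k * P k = 1 := by
  induction k with
  | zero => exact hP0
  | succ k ih =>
    have hDk := denominator_posDef hl hT (infoMatrix_posDef hl hT hR k) ih (φ k)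
    rw [← hD k] at hDk
    have hg := info_mul_gain ((isUnit_iff_isUnit_det _).1 hT.isUnit) ih (hD k)
      ((isUnit_iff_isUnit_det _).1 hDk.isUnit)
    rw [hP, infoMatrix, Matrix.mul_smul, ← Matrix.mul_assoc, Matrix.mul_sub, Matrix.mul_one,
      ← Matrix.mul_assoc _ (P k * φ k * (D k)⁻¹), hg, add_sub_cancel_right, Matrix.smul_mul, ih,
      smul_smul, inv_mul_cancel₀ hl.ne', one_smul]

/-- The information-weighted error evolves linearly. -/
lemma info_mulVec_error {R P : Matrix (Fin S) (Fin S) ℝ} {D : Matrix (Fin n) (Fin n) ℝ}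
    {ψ : Matrix (Fin S) (Fin n) ℝ} (hT : IsUnit T.det) (hRP : R * P = 1)
    (hD : D = l • T + ψᵀ * P * ψ) (hDu : IsUnit D.det) (e : Fin S → ℝ) (w : Fin n → ℝ) :
    (l • R + ψ * T⁻¹ * ψᵀ) *ᵥ (e - (P * ψ * D⁻¹) *ᵥ (ψᵀ *ᵥ e + w)) =
      l • (R *ᵥ e) - (ψ * T⁻¹) *ᵥ w := by
  rw [mulVec_sub, mulVec_mulVec, info_mul_gain hT hRP hD hDu, mulVec_add, mulVec_mulVec,
    add_mulVec, smul_mulVec]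
  abel

lemma dotProduct_mul_mul_transpose_mulVec {p q : ℕ} (A : Matrix (Fin p) (Fin q) ℝ)
    (B : Matrix (Fin q) (Fin q) ℝ) (v : Fin p → ℝ) :
    v ⬝ᵥ ((A * B * Aᵀ) *ᵥ v) = (Aᵀ *ᵥ v) ⬝ᵥ (B *ᵥ (Aᵀ *ᵥ v)) := by
  rw [← mulVec_mulVec, ← mulVec_mulVec, dotProduct_mulVec, mulVec_transpose A v]

lemma dotProduct_mul_transpose_mulVec {p q : ℕ} (A : Matrix (Fin p) (Fin q) ℝ)
    (v : Fin p → ℝ) :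
    v ⬝ᵥ ((A * Aᵀ) *ᵥ v) = ‖WithLp.toLp 2 (Aᵀ *ᵥ v)‖ ^ 2 := by
  rw [← dotProduct_self_eq_norm_sq]
  simpa using dotProduct_mul_mul_transpose_mulVec A 1 v

lemma dotProduct_sum_gram_mulVec (s : Finset ℕ) (v : Fin S → ℝ) :
    v ⬝ᵥ ((∑ i ∈ s, φ i * (φ i)ᵀ) *ᵥ v) = ∑ i ∈ s, ‖WithLp.toLp 2 ((φ i)ᵀ *ᵥ v)‖ ^ 2 := by
  simp only [sum_mulVec, dotProduct_sum, dotProduct_mul_transpose_mulVec]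

lemma le_dotProduct_infoMatrix_mulVec (hl0 : 0 < l) (hl1 : l ≤ 1) (hT : T.PosDef)
    (hR : R₀.PosDef) {τ : ℝ} (hτ : 0 ≤ τ)
    (hTτ : ∀ v, τ * ‖WithLp.toLp 2 v‖ ^ 2 ≤ v ⬝ᵥ (T⁻¹ *ᵥ v)) (j m : ℕ) (v : Fin S → ℝ) :
    l ^ m * (τ * ∑ i ∈ Finset.Ico j (j + m), ‖WithLp.toLp 2 ((φ i)ᵀ *ᵥ v)‖ ^ 2) ≤
      v ⬝ᵥ (infoMatrix l T R₀ φ (j + m) *ᵥ v) := by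
  induction m with
  | zero =>
    simpa using (infoMatrix_posDef (φ := φ) hl0 hT hR j).posSemidef.dotProduct_mulVec_nonneg v
  | succ m ih =>
    rw [← add_assoc, Finset.sum_Ico_succ_top (by omega), infoMatrix, add_mulVec, smul_mulVec,
      dotProduct_add, dotProduct_smul, smul_eq_mul, dotProduct_mul_mul_transpose_mulVec]
    have h1 := hTτ ((φ (j + m))ᵀ *ᵥ v)
    have h2 : l ^ (m + 1) ≤ 1 := pow_le_one₀ hl0.le hl1
    have h3 : l ^ (m + 1) * (τ * ‖WithLp.toLp 2 ((φ (j + m))ᵀ *ᵥ v)‖ ^ 2) ≤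
        τ * ‖WithLp.toLp 2 ((φ (j + m))ᵀ *ᵥ v)‖ ^ 2 :=
      mul_le_of_le_one_left (by positivity) h2
    have h4 := mul_le_mul_of_nonneg_left ih hl0.le
    rw [pow_succ] at h3 ⊢
    linarith

/-- A bound on `ψ ψᵀ` yields a bound on the operator norm of `ψ`. -/
lemma norm_mulVec_le_sqrt {ψ : Matrix (Fin S) (Fin n) ℝ} {β : ℝ}
    (h : ∀ y, ‖WithLp.toLp 2 (ψᵀ *ᵥ y)‖ ^ 2 ≤ β * ‖WithLp.toLp 2 y‖ ^ 2) (v : Fin n → ℝ) :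
    ‖WithLp.toLp 2 (ψ *ᵥ v)‖ ≤ Real.sqrt β * ‖WithLp.toLp 2 v‖ := by
  set y := ψ *ᵥ v with hy
  have h1 : ‖WithLp.toLp 2 (ψᵀ *ᵥ y)‖ ≤ Real.sqrt β * ‖WithLp.toLp 2 y‖ := by
    have h1' := Real.sqrt_le_sqrt (h y)
    rwa [Real.sqrt_sq (norm_nonneg _), Real.sqrt_mul' _ (sq_nonneg _),
      Real.sqrt_sq (norm_nonneg _)] at h1'
  have h2 : ‖WithLp.toLp 2 y‖ ^ 2 ≤ ‖WithLp.toLp 2 (ψᵀ *ᵥ y)‖ * ‖WithLp.toLp 2 v‖ := by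
    rw [← dotProduct_self_eq_norm_sq]
    nth_rewrite 2 [hy]
    rw [dotProduct_mulVec, ← mulVec_transpose]
    exact dotProduct_le_norm_mul_norm _ _
  rcases (norm_nonneg (WithLp.toLp 2 y)).eq_or_lt with h0 | h0
  · rw [← h0]; positivity
  · refine le_of_mul_le_mul_left ?_ h0
    nlinarith [mul_le_mul_of_nonneg_right h1 (norm_nonneg (WithLp.toLp 2 v))]

end Information

end RLS


/-- RLS with forgetting factor under persistence of
excitation and bounded disturbance: exponential convergence to a ball.
Here `P k` plays the role of `P_{k-1}` of the paper, so `P 0` is the initial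
covariance `P_{-1} = Pinit`, and Euclidean norms are written as
`Real.sqrt (v ⬝ᵥ v)`; `λ^{k/2}` is written `(Real.sqrt λ)^k`.  The constants
`γ₁, γ₂` depend only on `λ, M, α, β, T` and `P_{-1}`. -/
theorem rls_noisy_convergence_to_ball
    {S n : ℕ} (l : ℝ) (hl0 : 0 < l) (hl1 : l < 1)
    (T : Matrix (Fin n) (Fin n) ℝ) (hT : T.PosDef)
    (Pinit : Matrix (Fin S) (Fin S) ℝ) (hPinit : Pinit.PosDef)
    (M : ℕ) (hM : 1 ≤ M) (α β : ℝ) (hα : 0 < α) (hαβ : α ≤ β) :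
    ∃ γ₁ γ₂ : ℝ, 0 < γ₁ ∧ 0 < γ₂ ∧
      ∀ (φ : ℕ → Matrix (Fin S) (Fin n) ℝ)
        (θ : Fin S → ℝ) (θhat : ℕ → (Fin S → ℝ))
        (xt : ℕ → (Fin n → ℝ)) (w : ℕ → (Fin n → ℝ)) (wbar : ℝ)
        (P : ℕ → Matrix (Fin S) (Fin S) ℝ)
        (D : ℕ → Matrix (Fin n) (Fin n) ℝ),
        P 0 = Pinit →
        (∀ j : ℕ,
          (∑ i ∈ Finset.Ico j (j + M), φ i * (φ i)ᵀ -
            α • (1 : Matrix (Fin S) (Fin S) ℝ)).PosSemidef) →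
        (∀ j : ℕ,
          (β • (1 : Matrix (Fin S) (Fin S) ℝ) -
            ∑ i ∈ Finset.Ico j (j + M), φ i * (φ i)ᵀ).PosSemidef) →
        (∀ k, Real.sqrt (w k ⬝ᵥ w k) ≤ wbar) →
        (∀ k, xt (k + 1) = (φ k)ᵀ *ᵥ θ + w k) →
        (∀ k, D k = l • T + (φ k)ᵀ * P k * φ k) →
        (∀ k, θhat (k + 1) =
          θhat k + (P k * φ k * (D k)⁻¹) *ᵥ (xt (k + 1) - (φ k)ᵀ *ᵥ θhat k)) →
        (∀ k, P (k + 1) =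
          l⁻¹ • (((1 : Matrix (Fin S) (Fin S) ℝ) -
            P k * φ k * (D k)⁻¹ * (φ k)ᵀ) * P k)) →
        ∀ k, M ≤ k →
          Real.sqrt ((θ - θhat k) ⬝ᵥ (θ - θhat k)) ≤
            γ₁ * Real.sqrt l ^ k * Real.sqrt ((θ - θhat 0) ⬝ᵥ (θ - θhat 0)) +
              γ₂ * ((1 - Real.sqrt l ^ k) / (1 - Real.sqrt l)) * wbar := by
  have hR₀ := hPinit.inv
  obtain ⟨τ, hτ, hTτ⟩ := RLS.PosDef.exists_norm_sq_le hT.inv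
  obtain ⟨C₀, hC₀, hR₀C⟩ := RLS.exists_norm_mulVec_le Pinit⁻¹
  obtain ⟨C₁, hC₁, hTC⟩ := RLS.exists_norm_mulVec_le T⁻¹
  have hβ : 0 < β := hα.trans_le hαβ
  have hs0 : 0 < Real.sqrt l := Real.sqrt_pos.2 hl0
  have hs1 : Real.sqrt l < 1 := by rw [Real.sqrt_lt' one_pos]; simpa using hl1
  have hls : l ≤ Real.sqrt l := by nlinarith [Real.mul_self_sqrt hl0.le]
  set s := Real.sqrt l with hs
  set c := l ^ M * (τ * α) with hc
  have hc0 : 0 < c := by positivity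
  set B := Real.sqrt β * C₁ with hB
  have hB0 : 0 < B := by positivity
  refine ⟨C₀ / c, B / c, by positivity, by positivity, ?_⟩
  intro φ θ θhat xt w wbar P D hP0 hlow hup hw hx hD hθ hP k hk
  have hPE : ∀ j v, α * ‖WithLp.toLp 2 v‖ ^ 2 ≤
      ∑ i ∈ Finset.Ico j (j + M), ‖WithLp.toLp 2 ((φ i)ᵀ *ᵥ v)‖ ^ 2 := fun j v => by
    have h := (hlow j).dotProduct_mulVec_nonneg v
    rw [sub_mulVec, dotProduct_sub, star_trivial, RLS.dotProduct_sum_gram_mulVec, smul_mulVec,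
      one_mulVec, dotProduct_smul, smul_eq_mul, RLS.dotProduct_self_eq_norm_sq] at h
    linarith
  have hφ : ∀ j y, ‖WithLp.toLp 2 ((φ j)ᵀ *ᵥ y)‖ ^ 2 ≤ β * ‖WithLp.toLp 2 y‖ ^ 2 := fun j y => by
    have h := (hup j).dotProduct_mulVec_nonneg y
    rw [sub_mulVec, dotProduct_sub, star_trivial, RLS.dotProduct_sum_gram_mulVec, smul_mulVec,
      one_mulVec, dotProduct_smul, smul_eq_mul, RLS.dotProduct_self_eq_norm_sq] at h
    have h' := Finset.single_le_sum (f := fun i => ‖WithLp.toLp 2 ((φ i)ᵀ *ᵥ y)‖ ^ 2)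
      (fun i _ => sq_nonneg _) (Finset.mem_Ico.2 ⟨le_refl j, by omega⟩ : j ∈ Finset.Ico j (j + M))
    linarith
  have hRP0 : Pinit⁻¹ * P 0 = 1 := by
    rw [hP0, nonsing_inv_mul _ ((isUnit_iff_isUnit_det _).1 hPinit.isUnit)]
  set R := RLS.infoMatrix l T Pinit⁻¹ φ with hR
  have hRP : ∀ k, R k * P k = 1 := RLS.infoMatrix_mul_covariance hl0 hT hR₀ hRP0 hD hP
  have hz : ∀ k, R (k + 1) *ᵥ (θ - θhat (k + 1)) =
      l • (R k *ᵥ (θ - θhat k)) - (φ k * T⁻¹) *ᵥ w k := fun k => by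
    have hDk : (D k).PosDef := by
      rw [hD k]
      exact RLS.denominator_posDef hl0 hT (RLS.infoMatrix_posDef hl0 hT hR₀ k) (hRP k) (φ k)
    rw [← RLS.info_mulVec_error ((isUnit_iff_isUnit_det _).1 hT.isUnit) (hRP k) (hD k)
      ((isUnit_iff_isUnit_det _).1 hDk.isUnit)]
    change R (k + 1) *ᵥ _ = R (k + 1) *ᵥ _
    rw [hθ, hx, mulVec_sub (φ k)ᵀ]
    congr 1
    rw [sub_add_eq_sub_sub, add_sub_right_comm]
  have hdist : ∀ k, ‖WithLp.toLp 2 ((φ k * T⁻¹) *ᵥ w k)‖ ≤ B * wbar := fun k => by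
    have h := hw k
    rw [RLS.sqrt_dotProduct_self] at h
    rw [← mulVec_mulVec]
    calc _ ≤ Real.sqrt β * ‖WithLp.toLp 2 (T⁻¹ *ᵥ w k)‖ := RLS.norm_mulVec_le_sqrt (hφ k) _
      _ ≤ Real.sqrt β * (C₁ * wbar) := by
        gcongr
        exact (hTC _).trans (by gcongr)
      _ = B * wbar := by rw [hB]; ring
  have hbound : ∀ k, ‖WithLp.toLp 2 (R k *ᵥ (θ - θhat k))‖ ≤
      s ^ k * (C₀ * ‖WithLp.toLp 2 (θ - θhat 0)‖) +
        (∑ i ∈ Finset.range k, s ^ i) * (B * wbar) := fun k => by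
    induction k with
    | zero => simpa [hR, RLS.infoMatrix] using hR₀C (θ - θhat 0)
    | succ k ih =>
      rw [hz, geom_sum_succ, WithLp.toLp_sub, WithLp.toLp_smul]
      calc _ ≤ l * ‖WithLp.toLp 2 (R k *ᵥ (θ - θhat k))‖ + B * wbar := by
            refine (norm_sub_le _ _).trans (add_le_add ?_ (hdist k))
            rw [norm_smul, Real.norm_of_nonneg hl0.le]
        _ ≤ s * (s ^ k * (C₀ * ‖WithLp.toLp 2 (θ - θhat 0)‖) +
              (∑ i ∈ Finset.range k, s ^ i) * (B * wbar)) + B * wbar := by gcongr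
        _ = _ := by ring
  have hcoer : c * ‖WithLp.toLp 2 (θ - θhat k)‖ ^ 2 ≤
      (θ - θhat k) ⬝ᵥ (R k *ᵥ (θ - θhat k)) := by
    obtain ⟨j, rfl⟩ : ∃ j, k = j + M := ⟨k - M, by omega⟩
    refine le_trans ?_ (RLS.le_dotProduct_infoMatrix_mulVec hl0 hl1.le hT hR₀ hτ.le hTτ j M _)
    rw [hc, mul_assoc, mul_assoc]
    gcongr
    exact hPE j _
  have hmain : c * ‖WithLp.toLp 2 (θ - θhat k)‖ ≤ ‖WithLp.toLp 2 (R k *ᵥ (θ - θhat k))‖ := by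
    rcases (norm_nonneg (WithLp.toLp 2 (θ - θhat k))).eq_or_lt with h0 | h0
    · rw [← h0, mul_zero]; positivity
    · refine le_of_mul_le_mul_left ?_ h0
      linarith [RLS.dotProduct_le_norm_mul_norm (θ - θhat k) (R k *ᵥ (θ - θhat k))]
  have hgeom : ∑ i ∈ Finset.range k, s ^ i = (1 - s ^ k) / (1 - s) := by
    rw [geom_sum_eq hs1.ne, ← neg_div_neg_eq, neg_sub, neg_sub]
  rw [RLS.sqrt_dotProduct_self, RLS.sqrt_dotProduct_self, ← hgeom]
  have hfin := (le_div_iff₀' hc0).2 (hmain.trans (hbound k))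
  refine hfin.trans_eq ?_
  ring
end

section
/- Under the hypotheses of the previous result (f, κ, V_δ, constants c_l, c_u, δ_loc, k_max > 0, ρ ∈ (0,1) with the quadratic bounds, control bound and geometric decrease on the sublevel set V_δ ≤ δ_loc; reference trajectory x_r(k+1) = f(x_r(k), u_r(k)); closed loop x_f(k+1) = f(x_f(k), κ(x_f(k), x_r(k), u_r(k))) with V_δ(x_f(0), x_r(0), u_r(0)) ≤ δ_loc), let additionally Q ∈ ℝ^{n×n} and R ∈ ℝ^{m×m} be symmetric positive definite. Then the infinite-horizon tracking cost satisfies Σ_{i=0}^{∞} [ |x_f(i) − x_r(i)|²_Q + |κ(x_f(i), x_r(i), u_r(i)) − u_r(i)|²_R ] ≤ [(λ_max(Q) + λ_max(R))(1 + k_max²) / (c_l (1 − ρ))] · V_δ(x_f(0), x_r(0), u_r(0)) ≤ γ |x_f(0) − x_r(0)|², where γ = c_u (λ_max(Q) + λ_max(R))(1 + k_max²) / (c_l (1 − ρ)). -/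
open Matrix

namespace Matrix

/-- The Rayleigh bound: the quadratic form of a real symmetric matrix is at most its largest
eigenvalue times the squared Euclidean norm. -/
theorem IsHermitian.dotProduct_mulVec_le_iSup_eigenvalues {ι : Type*} [Fintype ι] [DecidableEq ι]
    {A : Matrix ι ι ℝ} (hA : A.IsHermitian) (v : ι → ℝ) :
    v ⬝ᵥ A *ᵥ v ≤ (⨆ i, hA.eigenvalues i) * (v ⬝ᵥ v) := by
  have hpos : (algebraMap ℝ (Matrix ι ι ℝ) (⨆ i, hA.eigenvalues i) - A).PosSemidef := by
    refine posSemidef_iff_isHermitian_and_spectrum_nonneg.2 ⟨?_, ?_⟩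
    · refine IsHermitian.sub ?_ hA
      simp [IsHermitian, algebraMap_eq_diagonal]
    · rw [← spectrum.singleton_sub_eq, hA.spectrum_real_eq_range_eigenvalues]
      rintro _ ⟨_, rfl, _, ⟨i, rfl⟩, rfl⟩
      exact sub_nonneg.2 (le_ciSup (Set.finite_range hA.eigenvalues).bddAbove i)
  have h := hpos.dotProduct_mulVec_nonneg v
  rw [star_trivial, sub_mulVec, dotProduct_sub, Algebra.algebraMap_eq_smul_one, smul_mulVec, one_mulVec,
    dotProduct_smul, smul_eq_mul] at h
  linarith

theorem PosSemidef.iSup_eigenvalues_nonneg {ι : Type*} [Fintype ι] [DecidableEq ι]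
    {A : Matrix ι ι ℝ} (hA : A.PosSemidef) : 0 ≤ ⨆ i, hA.1.eigenvalues i :=
  Real.iSup_nonneg hA.eigenvalues_nonneg

end Matrix

/-- A nonnegative sequence dominated by a geometric one is summable, with the expected bound. -/
theorem summable_and_tsum_le_of_le_geometric {a : ℕ → ℝ} {C r : ℝ} (ha : ∀ i, 0 ≤ a i)
    (hr0 : 0 ≤ r) (hr1 : r < 1) (h : ∀ i, a i ≤ C * r ^ i) :
    Summable a ∧ ∑' i, a i ≤ C / (1 - r) := by
  have hs := (hasSum_geometric_of_lt_one hr0 hr1).mul_left C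
  have ha' := Summable.of_nonneg_of_le ha h hs.summable
  exact ⟨ha', (ha'.tsum_le_tsum h hs.summable).trans_eq hs.tsum_eq⟩

/-- infinite-horizon tracking-cost bound under local
incremental stabilizability.  Weighted squared norms are written as
`|v|²_W = v ⬝ᵥ W *ᵥ v`, Euclidean norms via dot products, and `λ_max` via the
supremum of the eigenvalues of a symmetric matrix. -/
theorem incremental_stabilizability_cost_bound
    {n m : ℕ} (hn : 0 < n) (hm : 0 < m)
    (f : (Fin n → ℝ) × (Fin m → ℝ) → (Fin n → ℝ))
    (κ : (Fin n → ℝ) → (Fin n → ℝ) → (Fin m → ℝ) → (Fin m → ℝ))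
    (Vδ : (Fin n → ℝ) → (Fin n → ℝ) → (Fin m → ℝ) → ℝ)
    (hVnonneg : ∀ x x' u', 0 ≤ Vδ x x' u')
    (c_l c_u δloc kmax ρ : ℝ)
    (hcl : 0 < c_l) (hcu : 0 < c_u) (hδ : 0 < δloc) (hk : 0 < kmax)
    (hρ0 : 0 < ρ) (hρ1 : ρ < 1)
    (hlow : ∀ x x' u', Vδ x x' u' ≤ δloc →
      c_l * ((x - x') ⬝ᵥ (x - x')) ≤ Vδ x x' u')
    (hup : ∀ x x' u', Vδ x x' u' ≤ δloc →
      Vδ x x' u' ≤ c_u * ((x - x') ⬝ᵥ (x - x')))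
    (hκ : ∀ x x' u', Vδ x x' u' ≤ δloc →
      Real.sqrt ((κ x x' u' - u') ⬝ᵥ (κ x x' u' - u')) ≤
        kmax * Real.sqrt ((x - x') ⬝ᵥ (x - x')))
    (x_r : ℕ → (Fin n → ℝ)) (u_r : ℕ → (Fin m → ℝ))
    (href : ∀ k, x_r (k + 1) = f (x_r k, u_r k))
    (hdec : ∀ k (x : Fin n → ℝ), Vδ x (x_r k) (u_r k) ≤ δloc →
      Vδ (f (x, κ x (x_r k) (u_r k))) (x_r (k + 1)) (u_r (k + 1)) ≤
        ρ * Vδ x (x_r k) (u_r k))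
    (x_f : ℕ → (Fin n → ℝ))
    (hclosed : ∀ k, x_f (k + 1) = f (x_f k, κ (x_f k) (x_r k) (u_r k)))
    (h0 : Vδ (x_f 0) (x_r 0) (u_r 0) ≤ δloc)
    (Q : Matrix (Fin n) (Fin n) ℝ) (R : Matrix (Fin m) (Fin m) ℝ)
    (hQ : Q.PosDef) (hR : R.PosDef) :
    Summable (fun i =>
      (x_f i - x_r i) ⬝ᵥ Q *ᵥ (x_f i - x_r i) +
        (κ (x_f i) (x_r i) (u_r i) - u_r i) ⬝ᵥ R *ᵥ
          (κ (x_f i) (x_r i) (u_r i) - u_r i)) ∧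
    (∑' i, ((x_f i - x_r i) ⬝ᵥ Q *ᵥ (x_f i - x_r i) +
        (κ (x_f i) (x_r i) (u_r i) - u_r i) ⬝ᵥ R *ᵥ
          (κ (x_f i) (x_r i) (u_r i) - u_r i))) ≤
      ((⨆ i, hQ.1.eigenvalues i) + (⨆ j, hR.1.eigenvalues j)) * (1 + kmax ^ 2) /
          (c_l * (1 - ρ)) * Vδ (x_f 0) (x_r 0) (u_r 0) ∧
    ((⨆ i, hQ.1.eigenvalues i) + (⨆ j, hR.1.eigenvalues j)) * (1 + kmax ^ 2) /
        (c_l * (1 - ρ)) * Vδ (x_f 0) (x_r 0) (u_r 0) ≤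
      (c_u * ((⨆ i, hQ.1.eigenvalues i) + (⨆ j, hR.1.eigenvalues j)) *
          (1 + kmax ^ 2) / (c_l * (1 - ρ))) *
        ((x_f 0 - x_r 0) ⬝ᵥ (x_f 0 - x_r 0)) := by
  have hV : ∀ i, Vδ (x_f i) (x_r i) (u_r i) ≤ δloc ∧
      Vδ (x_f i) (x_r i) (u_r i) ≤ ρ ^ i * Vδ (x_f 0) (x_r 0) (u_r 0) := by
    intro i
    induction i with
    | zero => exact ⟨h0, by simp⟩
    | succ k ih =>
      have hd := hdec k (x_f k) ih.1
      rw [← hclosed k] at hd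
      have hle := mul_le_mul_of_nonneg_left ih.2 hρ0.le
      refine ⟨?_, hd.trans (hle.trans_eq (by ring))⟩
      exact hd.trans ((mul_le_of_le_one_left (hVnonneg _ _ _) hρ1.le).trans ih.1)
  set q := ⨆ i, hQ.1.eigenvalues i
  set r := ⨆ j, hR.1.eigenvalues j
  set V₀ := Vδ (x_f 0) (x_r 0) (u_r 0)
  have hq : 0 ≤ q := hQ.posSemidef.iSup_eigenvalues_nonneg
  have hr : 0 ≤ r := hR.posSemidef.iSup_eigenvalues_nonneg
  have hρ : 0 < 1 - ρ := sub_pos.2 hρ1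
  have hstage : ∀ i, (x_f i - x_r i) ⬝ᵥ Q *ᵥ (x_f i - x_r i) +
      (κ (x_f i) (x_r i) (u_r i) - u_r i) ⬝ᵥ R *ᵥ (κ (x_f i) (x_r i) (u_r i) - u_r i) ≤
        (q + r) * (1 + kmax ^ 2) / c_l * V₀ * ρ ^ i := by
    intro i
    obtain ⟨hloc, hgeo⟩ := hV i
    have hQi := hQ.1.dotProduct_mulVec_le_iSup_eigenvalues (x_f i - x_r i)
    have hRi := hR.1.dotProduct_mulVec_le_iSup_eigenvalues (κ (x_f i) (x_r i) (u_r i) - u_r i)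
    have hκi := hκ _ _ _ hloc
    have hlowi := (hlow _ _ _ hloc).trans hgeo
    have he : 0 ≤ (x_f i - x_r i) ⬝ᵥ (x_f i - x_r i) := by
      simpa using dotProduct_star_self_nonneg (x_f i - x_r i)
    generalize x_f i - x_r i = e at *
    generalize κ (x_f i) (x_r i) (u_r i) - u_r i = w at *
    have hw : w ⬝ᵥ w ≤ kmax ^ 2 * (e ⬝ᵥ e) := by
      rw [Real.sqrt_le_left (by positivity), mul_pow, Real.sq_sqrt he] at hκi
      exact hκi
    calc e ⬝ᵥ Q *ᵥ e + w ⬝ᵥ R *ᵥ w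
        ≤ q * (e ⬝ᵥ e) + r * (kmax ^ 2 * (e ⬝ᵥ e)) :=
          add_le_add hQi (hRi.trans (mul_le_mul_of_nonneg_left hw hr))
      _ ≤ (q + r) * (1 + kmax ^ 2) * (e ⬝ᵥ e) := by
          have : 0 ≤ (q * kmax ^ 2 + r) * (e ⬝ᵥ e) := by positivity
          linarith
      _ ≤ (q + r) * (1 + kmax ^ 2) * (ρ ^ i * V₀ / c_l) := by
          refine mul_le_mul_of_nonneg_left ?_ (by positivity)
          rwa [le_div_iff₀ hcl, mul_comm]
      _ = (q + r) * (1 + kmax ^ 2) / c_l * V₀ * ρ ^ i := by ring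
  have hnonneg : ∀ i, 0 ≤ (x_f i - x_r i) ⬝ᵥ Q *ᵥ (x_f i - x_r i) +
      (κ (x_f i) (x_r i) (u_r i) - u_r i) ⬝ᵥ R *ᵥ (κ (x_f i) (x_r i) (u_r i) - u_r i) := fun i =>
    add_nonneg (hQ.posSemidef.dotProduct_mulVec_nonneg _)
      (hR.posSemidef.dotProduct_mulVec_nonneg _)
  obtain ⟨hsum, hle⟩ := summable_and_tsum_le_of_le_geometric hnonneg hρ0.le hρ1 hstage
  refine ⟨hsum, hle.trans_eq (by field_simp), ?_⟩
  calc (q + r) * (1 + kmax ^ 2) / (c_l * (1 - ρ)) * V₀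
      ≤ (q + r) * (1 + kmax ^ 2) / (c_l * (1 - ρ)) *
          (c_u * ((x_f 0 - x_r 0) ⬝ᵥ (x_f 0 - x_r 0))) :=
        mul_le_mul_of_nonneg_left (hup _ _ _ h0) (by positivity)
    _ = c_u * (q + r) * (1 + kmax ^ 2) / (c_l * (1 - ρ)) *
          ((x_f 0 - x_r 0) ⬝ᵥ (x_f 0 - x_r 0)) := by ring
end
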